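/- arXiv:2601.18559 — 3 statements merged into one kernel-verified Lean document; each statement's English description precedes it below -/
import Mathlib

section
/- For every integer s ≥ 1 and every real number c, the measure η_c^s := f_c·ν_s + 1_{c<0}·((e^{-c} − e^{c})/(e^{-c} + √s))·δ_{e^{c}+√s+e^{-c}} is a Borel probability measure on ℝ, and for every n ∈ ℕ one has ∫ Q_n^s dη_c^s = e^{-cn}. -/
open MeasureTheory Polynomial Filter

/-- The orthogonal polynomials `Q_n^s`: `Q_0 = 1`, `Q_1 = X`,
`X * Q_n = Q_{n+1} + √s * Q_n + Q_{n-1}`. -/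
noncomputable def Qpoly (s : ℕ) : ℕ → Polynomial ℝ
  | 0 => 1
  | 1 => Polynomial.X
  | (n + 2) => Polynomial.X * Qpoly s (n + 1)
      - Polynomial.C (Real.sqrt s) * Qpoly s (n + 1) - Qpoly s n

/-- Chebyshev polynomials of the second kind: `P_0 = 1`, `P_1 = X`,
`X * P_n = P_{n+1} + P_{n-1}`. -/
noncomputable def Ppoly : ℕ → Polynomial ℝ
  | 0 => 1
  | 1 => Polynomial.X
  | (n + 2) => Polynomial.X * Ppoly (n + 1) - Ppoly n

/-- The density of the absolutely continuous part of `ν_s`. -/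
noncomputable def nuDensity (s : ℕ) (x : ℝ) : ℝ :=
  Real.sqrt (4 - (x - Real.sqrt s) ^ 2) / (2 * Real.pi * (x * Real.sqrt s + 1))

/-- The free Meixner measure `ν_s`. -/
noncomputable def nuMeas (s : ℕ) : Measure ℝ :=
  volume.withDensity (fun x => ENNReal.ofReal
      (if |x - Real.sqrt s| ≤ 2 then nuDensity s x else 0))
    + ENNReal.ofReal (1 - 1 / (s : ℝ)) • Measure.dirac (-1 / Real.sqrt s)

/-- The density `f_c`. -/
noncomputable def fc (s : ℕ) (c x : ℝ) : ℝ :=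
  (Real.exp c + Real.sqrt s) / (Real.exp c + Real.exp (-c) + Real.sqrt s - x)

/-- The measure `η_c^s = f_c · ν_s + 1_{c<0} ((e^{-c}-e^c)/(e^{-c}+√s)) δ_{e^c+√s+e^{-c}}`. -/
noncomputable def etaMeas (s : ℕ) (c : ℝ) : Measure ℝ :=
  (nuMeas s).withDensity (fun x => ENNReal.ofReal (fc s c x))
    + (if c < 0 then
        ENNReal.ofReal ((Real.exp (-c) - Real.exp c) / (Real.exp (-c) + Real.sqrt s))
      else 0) • Measure.dirac (Real.exp c + Real.sqrt s + Real.exp (-c))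

/-- Total variation distance between two Borel measures on `ℝ`. -/
noncomputable def dTV (μ ν : Measure ℝ) : ℝ :=
  ⨆ A : {A : Set ℝ // MeasurableSet A}, |(μ A.1).toReal - (ν A.1).toReal|

open Set in
/-- The substitution `x = r + 2 cos θ` in an integral against the semicircle density. -/
theorem setIntegral_semicircle_substitution (r : ℝ) (g : ℝ → ℝ) :
    ((IntegrableOn (fun x => √(4 - (x - r) ^ 2) * g x) {x | |x - r| ≤ 2}) ↔
      IntegrableOn (fun θ => 4 * Real.sin θ ^ 2 * g (r + 2 * Real.cos θ)) (Ioo 0 Real.pi)) ∧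
    ∫ x in {x | |x - r| ≤ 2}, √(4 - (x - r) ^ 2) * g x =
      ∫ θ in Ioo 0 Real.pi, 4 * Real.sin θ ^ 2 * g (r + 2 * Real.cos θ) := by
  have himage : (fun θ => r + 2 * Real.cos θ) '' Icc 0 Real.pi = {x | |x - r| ≤ 2} := by
    ext x
    constructor
    · rintro ⟨θ, -, rfl⟩
      have h₁ := Real.cos_le_one θ
      have h₂ := Real.neg_one_le_cos θ
      simp only [mem_ofPred_eq, abs_le]
      constructor <;> linarith
    · intro hx
      simp only [mem_ofPred_eq, abs_le] at hx
      obtain ⟨θ, hθ, h⟩ := Real.bijOn_cos.surjOn (show (x - r) / 2 ∈ Icc (-1 : ℝ) 1 by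
        constructor <;> linarith [hx.1, hx.2])
      refine ⟨θ, hθ, ?_⟩
      simp only [h]
      ring
  have hderiv : ∀ θ ∈ Icc 0 Real.pi, HasDerivWithinAt (fun θ => r + 2 * Real.cos θ)
      (-(2 * Real.sin θ)) (Icc 0 Real.pi) θ := fun θ _ => by
    have := (((Real.hasDerivAt_cos θ).const_mul 2).const_add r).hasDerivWithinAt (s := Icc 0 Real.pi)
    simpa using this
  have hinj : InjOn (fun θ => r + 2 * Real.cos θ) (Icc 0 Real.pi) := fun a ha b hb h =>
    Real.bijOn_cos.injOn ha hb (by simpa using h)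
  have hcongr : EqOn (fun θ => |-(2 * Real.sin θ)| •
        (√(4 - (r + 2 * Real.cos θ - r) ^ 2) * g (r + 2 * Real.cos θ)))
      (fun θ => 4 * Real.sin θ ^ 2 * g (r + 2 * Real.cos θ)) (Icc 0 Real.pi) := by
    intro θ hθ
    have hsin := Real.sin_nonneg_of_mem_Icc hθ
    have h : 4 - (r + 2 * Real.cos θ - r) ^ 2 = (2 * Real.sin θ) ^ 2 := by
      linear_combination (-4) * Real.sin_sq_add_cos_sq θ
    simp only [h, abs_neg, smul_eq_mul, abs_of_nonneg (show 0 ≤ 2 * Real.sin θ by linarith)]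
    rw [Real.sqrt_sq (by linarith)]
    ring
  rw [← himage, integrableOn_image_iff_integrableOn_abs_deriv_smul measurableSet_Icc hderiv hinj,
    integral_image_eq_integral_abs_deriv_smul measurableSet_Icc hderiv hinj,
    integrableOn_congr_fun hcongr measurableSet_Icc,
    setIntegral_congr_fun measurableSet_Icc hcongr,
    integrableOn_Icc_iff_integrableOn_Ioo, integral_Icc_eq_integral_Ioo]
  exact ⟨Iff.rfl, rfl⟩

theorem sub_two_mul_cos_pos {t : ℝ} (ht : |t| < 1) (θ : ℝ) :
    0 < 1 - 2 * t * Real.cos θ + t ^ 2 := by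
  have h₁ : |t * Real.cos θ| ≤ |t| := by
    rw [abs_mul]
    exact mul_le_of_le_one_right (abs_nonneg t) (Real.abs_cos_le_one θ)
  have h₂ := le_abs_self (t * Real.cos θ)
  nlinarith [sq_abs t]

/-- The integral of the Poisson kernel over a half circle. -/
theorem integral_poisson_kernel {t : ℝ} (ht : |t| < 1) :
    ∫ θ in (0 : ℝ)..Real.pi, (1 - t ^ 2) / (1 - 2 * t * Real.cos θ + t ^ 2) = Real.pi := by
  have hderiv : ∀ θ ∈ Set.uIcc 0 Real.pi, HasDerivAt
      (fun θ => θ + 2 * Real.arctan (t * Real.sin θ / (1 - t * Real.cos θ)))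
      ((1 - t ^ 2) / (1 - 2 * t * Real.cos θ + t ^ 2)) θ := by
    intro θ _
    have hpos := sub_two_mul_cos_pos ht θ
    have hne : 1 - t * Real.cos θ ≠ 0 := by
      have h₁ : |t * Real.cos θ| ≤ |t| := by
        rw [abs_mul]
        exact mul_le_of_le_one_right (abs_nonneg t) (Real.abs_cos_le_one θ)
      have h₂ := le_abs_self (t * Real.cos θ)
      linarith
    have hnum := (Real.hasDerivAt_sin θ).const_mul t
    have hden := ((Real.hasDerivAt_cos θ).const_mul t).const_sub 1
    have h := (hasDerivAt_id θ).add (((hnum.div hden hne).arctan).const_mul 2)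
    refine h.congr_deriv ?_
    have hsq : 1 + (t * Real.sin θ / (1 - t * Real.cos θ)) ^ 2 =
        (1 - 2 * t * Real.cos θ + t ^ 2) / (1 - t * Real.cos θ) ^ 2 := by
      field_simp
      linear_combination t ^ 2 * Real.sin_sq_add_cos_sq θ
    simp only [Pi.div_apply] at *
    rw [hsq]
    field_simp
    linear_combination (-2 * t ^ 2) * Real.sin_sq_add_cos_sq θ
  rw [intervalIntegral.integral_eq_sub_of_hasDerivAt hderiv]
  · simp
  · refine Continuous.intervalIntegrable ?_ _ _
    exact continuous_const.div (by fun_prop) fun θ => (sub_two_mul_cos_pos ht θ).ne'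

open Set in
theorem integral_sin_sq_div_sub_cos {t : ℝ} (ht₀ : t ≠ 0) (ht : |t| ≤ 1) :
    IntegrableOn (fun θ => 4 * Real.sin θ ^ 2 * (t + 1 / t - 2 * Real.cos θ)⁻¹) (Ioo 0 Real.pi) ∧
    ∫ θ in Ioo 0 Real.pi, 4 * Real.sin θ ^ 2 * (t + 1 / t - 2 * Real.cos θ)⁻¹ =
      2 * Real.pi * t := by
  have hcongr : EqOn (fun θ => 4 * Real.sin θ ^ 2 * (t + 1 / t - 2 * Real.cos θ)⁻¹)
      (fun θ => t + 1 / t + 2 * Real.cos θ -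
        (1 / t - t) * ((1 - t ^ 2) / (1 - 2 * t * Real.cos θ + t ^ 2))) (Ioo 0 Real.pi) := by
    intro θ hθ
    have hpos : 0 < 1 - 2 * t * Real.cos θ + t ^ 2 := by
      have hs := Real.sin_pos_of_mem_Ioo hθ
      nlinarith [sq_nonneg (t - Real.cos θ), Real.sin_sq_add_cos_sq θ]
    have h : t + 1 / t - 2 * Real.cos θ = (1 - 2 * t * Real.cos θ + t ^ 2) / t := by
      field_simp
      ring
    simp only [h]
    field_simp
    linear_combination (4 * t ^ 2) * Real.sin_sq_add_cos_sq θ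
  have hP : IntegrableOn (fun θ => (1 / t - t) *
        ((1 - t ^ 2) / (1 - 2 * t * Real.cos θ + t ^ 2))) (Ioo 0 Real.pi) ∧
      ∫ θ in Ioo 0 Real.pi, (1 / t - t) *
        ((1 - t ^ 2) / (1 - 2 * t * Real.cos θ + t ^ 2)) = (1 / t - t) * Real.pi := by
    rcases ht.lt_or_eq with hlt | heq
    · constructor
      · rw [← integrableOn_Icc_iff_integrableOn_Ioo]
        refine Continuous.integrableOn_Icc (continuous_const.mul ?_)
        exact continuous_const.div (by fun_prop) fun θ => (sub_two_mul_cos_pos hlt θ).ne'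
      · rw [integral_const_mul, ← integral_Ioc_eq_integral_Ioo,
          ← intervalIntegral.integral_of_le Real.pi_pos.le, integral_poisson_kernel hlt]
    · have h : 1 / t - t = 0 := by
        field_simp
        rw [← sq_abs, heq]
        ring
      simp only [h, zero_mul]
      simp
  have hL : IntegrableOn (fun θ => t + 1 / t + 2 * Real.cos θ) (Ioo 0 Real.pi) := by
    rw [← integrableOn_Icc_iff_integrableOn_Ioo]
    exact Continuous.integrableOn_Icc (by fun_prop)
  have hLint : ∫ θ in Ioo 0 Real.pi, (t + 1 / t + 2 * Real.cos θ) = (t + 1 / t) * Real.pi := by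
    rw [← integral_Ioc_eq_integral_Ioo, ← intervalIntegral.integral_of_le Real.pi_pos.le,
      intervalIntegral.integral_add (by simp)
        (Continuous.intervalIntegrable (by fun_prop) _ _)]
    simp
    ring
  rw [integrableOn_congr_fun hcongr measurableSet_Ioo,
    setIntegral_congr_fun measurableSet_Ioo hcongr]
  refine ⟨hL.sub hP.1, ?_⟩
  rw [integral_sub hL hP.1, hLint, hP.2]
  ring

/-- The Cauchy transform of the semicircle density at `r + t + 1 / t`. -/
theorem integral_semicircle_cauchy (r : ℝ) {t : ℝ} (ht₀ : t ≠ 0) (ht : |t| ≤ 1) :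
    IntegrableOn (fun x => √(4 - (x - r) ^ 2) * (r + t + 1 / t - x)⁻¹) {x | |x - r| ≤ 2} ∧
    ∫ x in {x | |x - r| ≤ 2}, √(4 - (x - r) ^ 2) * (r + t + 1 / t - x)⁻¹ =
      2 * Real.pi * t := by
  have h := setIntegral_semicircle_substitution r fun x => (r + t + 1 / t - x)⁻¹
  have hsub : ∀ θ, r + t + 1 / t - (r + 2 * Real.cos θ) = t + 1 / t - 2 * Real.cos θ :=
    fun θ => by ring
  simp only [hsub] at h
  have h' := integral_sin_sq_div_sub_cos ht₀ ht
  exact ⟨h.1.2 h'.1, h.2.trans h'.2⟩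

theorem sin_mul_eval_Qpoly (s n : ℕ) (θ : ℝ) :
    Real.sin θ * (Qpoly s n).eval (√s + 2 * Real.cos θ) =
      Real.sin ((n + 1) * θ) + √s * Real.sin (n * θ) := by
  induction n using Nat.twoStepInduction with
  | zero => simp [Qpoly]
  | one =>
    norm_num [Qpoly, Real.sin_two_mul]
    ring
  | more n h₀ h₁ =>
    have e : ∀ φ, Real.sin (φ + θ) + Real.sin (φ - θ) = 2 * Real.cos θ * Real.sin φ := by
      intro φ
      rw [Real.sin_add, Real.sin_sub]
      ring
    have e₁ := e ((n + 1 + 1) * θ)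
    have e₂ := e ((n + 1) * θ)
    simp only [Qpoly, eval_sub, eval_mul, eval_X, eval_C]
    push_cast at *
    rw [show (n + 1 + 1) * θ + θ = ((n : ℝ) + 2 + 1) * θ by ring,
      show (n + 1 + 1) * θ - θ = ((n : ℝ) + 1) * θ by ring] at e₁
    rw [show (n + 1) * θ + θ = ((n : ℝ) + 2) * θ by ring,
      show (n + 1) * θ - θ = (n : ℝ) * θ by ring] at e₂
    rw [show ((n : ℝ) + 1 + 1) = n + 2 by ring] at *
    linear_combination 2 * Real.cos θ * h₁ - h₀ - e₁ - √s * e₂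

theorem integral_sin_mul_sin_nat (k : ℕ) :
    ∫ θ in (0 : ℝ)..Real.pi, Real.sin θ * Real.sin (k * θ) =
      if k = 1 then Real.pi / 2 else 0 := by
  split_ifs with hk
  · subst hk
    have := integral_sin_sq (a := 0) (b := Real.pi)
    simp only [Nat.cast_one, one_mul, ← sq, this]
    simp
  · have hcos : ∀ m : ℤ, m ≠ 0 → ∫ θ in (0 : ℝ)..Real.pi, Real.cos (m * θ) = 0 := by
      intro m hm
      rw [intervalIntegral.integral_comp_mul_left (fun x => Real.cos x) (by exact_mod_cast hm)]
      simp [Real.sin_int_mul_pi]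
    have h₁ := hcos (k - 1) (by lia)
    have h₂ := hcos (k + 1) (by lia)
    push_cast at h₁ h₂
    have e : ∀ θ : ℝ, Real.sin θ * Real.sin (k * θ) =
        (Real.cos ((k - 1) * θ) - Real.cos ((k + 1) * θ)) / 2 := by
      intro θ
      rw [sub_mul, add_mul, one_mul, Real.cos_sub, Real.cos_add]
      ring
    simp only [e]
    rw [intervalIntegral.integral_div, intervalIntegral.integral_sub, h₁, h₂]
    · simp
    all_goals exact Continuous.intervalIntegrable (by fun_prop) _ _

/-- The moments of the semicircle density against the polynomials `Q_n^s`. -/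
theorem integral_semicircle_Qpoly (s n : ℕ) :
    ∫ x in {x | |x - √s| ≤ 2}, √(4 - (x - √s) ^ 2) * (Qpoly s n).eval x =
      2 * Real.pi * ((if n = 0 then 1 else 0) + √s * if n = 1 then 1 else 0) := by
  rw [(setIntegral_semicircle_substitution (√s) fun x => (Qpoly s n).eval x).2,
    ← integral_Ioc_eq_integral_Ioo, ← intervalIntegral.integral_of_le Real.pi_pos.le]
  have e : ∀ θ, 4 * Real.sin θ ^ 2 * (Qpoly s n).eval (√s + 2 * Real.cos θ) =
      4 * (Real.sin θ * Real.sin ((n + 1 : ℕ) * θ)) +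
        4 * √s * (Real.sin θ * Real.sin (n * θ)) := by
    intro θ
    push_cast
    linear_combination 4 * Real.sin θ * sin_mul_eval_Qpoly s n θ
  simp only [e]
  rw [intervalIntegral.integral_add, intervalIntegral.integral_const_mul,
    intervalIntegral.integral_const_mul, integral_sin_mul_sin_nat, integral_sin_mul_sin_nat]
  · simp only [Nat.add_eq_right]
    split_ifs <;> ring
  all_goals exact Continuous.intervalIntegrable (by fun_prop) _ _

theorem one_le_sqrt_natCast {s : ℕ} (hs : 1 ≤ s) : 1 ≤ √(s : ℝ) :=
  Real.one_le_sqrt.2 (by exact_mod_cast hs)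

theorem measurableSet_abs_sub_le (r : ℝ) : MeasurableSet {x : ℝ | |x - r| ≤ 2} :=
  measurableSet_le (by fun_prop) (by fun_prop)

theorem nuDensity_nonneg {s : ℕ} (hs : 1 ≤ s) {x : ℝ} (hx : |x - √s| ≤ 2) :
    0 ≤ nuDensity s x := by
  have hr := one_le_sqrt_natCast hs
  have h := (abs_le.1 hx).1
  refine div_nonneg (Real.sqrt_nonneg _) (mul_nonneg (by positivity) ?_)
  nlinarith [sq_nonneg (√(s : ℝ) - 1)]

theorem integrable_nuMeas {s : ℕ} (hs : 1 ≤ s) {h : ℝ → ℝ}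
    (hint : IntegrableOn (fun x => nuDensity s x * h x) {x | |x - √s| ≤ 2}) :
    Integrable h (nuMeas s) ∧
    ∫ x, h x ∂(nuMeas s) = (∫ x in {x | |x - √s| ≤ 2}, nuDensity s x * h x)
      + (1 - 1 / (s : ℝ)) * h (-1 / √s) := by
  have hS := measurableSet_abs_sub_le √(s : ℝ)
  have hmeas : Measurable fun x => ENNReal.ofReal
      (if |x - √s| ≤ 2 then nuDensity s x else 0) := by
    refine (Measurable.ite hS ?_ measurable_const).ennreal_ofReal
    unfold nuDensity
    fun_prop
  have hfin : ∀ᵐ x : ℝ, ENNReal.ofReal (if |x - √s| ≤ 2 then nuDensity s x else 0) < ⊤ :=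
    ae_of_all _ fun _ => ENNReal.ofReal_lt_top
  have heq : (fun x => (ENNReal.ofReal (if |x - √s| ≤ 2 then nuDensity s x else 0)).toReal • h x)
      = {x | |x - √s| ≤ 2}.indicator fun x => nuDensity s x * h x := by
    ext x
    by_cases hx : |x - √s| ≤ 2
    · simp [hx, ENNReal.toReal_ofReal (nuDensity_nonneg hs hx)]
    · simp [hx]
  have h₁ : Integrable h (volume.withDensity fun x => ENNReal.ofReal
      (if |x - √s| ≤ 2 then nuDensity s x else 0)) := by
    rw [integrable_withDensity_iff_integrable_smul' hmeas hfin, heq, integrable_indicator_iff hS]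
    exact hint
  have h₂ : Integrable h (ENNReal.ofReal (1 - 1 / (s : ℝ)) • Measure.dirac (-1 / √s)) :=
    (integrable_dirac (by simp)).smul_measure ENNReal.ofReal_ne_top
  refine ⟨h₁.add_measure h₂, ?_⟩
  have hs' : 1 / (s : ℝ) ≤ 1 := by
    rw [div_le_one₀ (by positivity)]
    exact_mod_cast hs
  rw [nuMeas, integral_add_measure h₁ h₂, integral_withDensity_eq_integral_toReal_smul hmeas hfin,
    heq, integral_indicator hS, integral_smul_measure, integral_dirac,
    ENNReal.toReal_ofReal (by linarith), smul_eq_mul]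

theorem ae_nuMeas (s : ℕ) {p : ℝ → Prop} (hp : ∀ᵐ x : ℝ, |x - √s| ≤ 2 → p x)
    (hp' : p (-1 / √s)) : ∀ᵐ x ∂(nuMeas s), p x := by
  have hmeas : Measurable fun x => ENNReal.ofReal
      (if |x - √s| ≤ 2 then nuDensity s x else 0) := by
    refine (Measurable.ite (measurableSet_abs_sub_le _) ?_ measurable_const).ennreal_ofReal
    unfold nuDensity
    fun_prop
  rw [nuMeas, ae_add_measure_iff, ae_withDensity_iff hmeas]
  constructor
  · filter_upwards [hp] with x hx hne
    refine hx (by_contra fun h => hne ?_)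
    simp [h]
  · refine Measure.ae_smul_measure ?_ _
    rw [ae_dirac_eq]
    exact hp'

theorem nuDensity_eq {s : ℕ} (hs : 1 ≤ s) (x : ℝ) : nuDensity s x =
    -(1 / (2 * Real.pi * √s)) *
      (√(4 - (x - √s) ^ 2) * (√s + -1 / √s + 1 / (-1 / √s) - x)⁻¹) := by
  have hr : 0 < √(s : ℝ) := one_pos.trans_le (one_le_sqrt_natCast hs)
  have h : √s + -1 / √s + 1 / (-1 / √s) - x = -((x * √s + 1) / √(s : ℝ)) := by
    field_simp
    ring
  rw [h, nuDensity, inv_neg, inv_div]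
  by_cases hx : x * √s + 1 = 0
  · simp [hx]
  · field_simp

theorem integral_nuDensity {s : ℕ} (hs : 1 ≤ s) :
    IntegrableOn (nuDensity s) {x | |x - √s| ≤ 2} ∧
    ∫ x in {x | |x - √s| ≤ 2}, nuDensity s x = 1 / s := by
  have hr := one_le_sqrt_natCast hs
  have ht : |-1 / √(s : ℝ)| ≤ 1 := by
    rw [abs_div, abs_neg, abs_one, abs_of_pos (by linarith), div_le_one₀ (by linarith)]
    exact hr
  have ht₀ : -1 / √(s : ℝ) ≠ 0 := div_ne_zero (by norm_num) (by linarith)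
  have h := integral_semicircle_cauchy √(s : ℝ) ht₀ ht
  rw [show nuDensity s = _ from funext (nuDensity_eq hs)]
  refine ⟨h.1.const_mul _, ?_⟩
  rw [integral_const_mul, h.2]
  have hsq : √(s : ℝ) ^ 2 = s := Real.sq_sqrt (by positivity)
  field_simp
  exact hsq.symm

theorem integral_nuMeas_one {s : ℕ} (hs : 1 ≤ s) :
    Integrable (fun _ => (1 : ℝ)) (nuMeas s) ∧ ∫ _, (1 : ℝ) ∂(nuMeas s) = 1 := by
  have h := integral_nuDensity hs
  have h' := integrable_nuMeas hs (h := fun _ => 1) (by simpa using h.1)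
  refine ⟨h'.1, h'.2.trans ?_⟩
  simp only [mul_one, h.2]
  ring

theorem isFiniteMeasure_nuMeas {s : ℕ} (hs : 1 ≤ s) : IsFiniteMeasure (nuMeas s) :=
  (integrable_const_iff.1 (integral_nuMeas_one hs).1).resolve_left one_ne_zero

theorem two_le_exp_add_exp_neg (c : ℝ) : 2 ≤ Real.exp c + Real.exp (-c) := by
  have h : Real.exp c * Real.exp (-c) = 1 := by rw [← Real.exp_add]; simp
  nlinarith [sq_nonneg (Real.exp c - Real.exp (-c)), Real.exp_pos c, Real.exp_pos (-c)]

theorem exp_neg_abs_add_inv (c : ℝ) :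
    Real.exp (-|c|) + 1 / Real.exp (-|c|) = Real.exp c + Real.exp (-c) := by
  rw [one_div, ← Real.exp_neg, neg_neg]
  rcases abs_cases c with ⟨h, -⟩ | ⟨h, -⟩ <;> rw [h]
  · ring
  · simp

theorem integral_fc {s : ℕ} (hs : 1 ≤ s) (c : ℝ) :
    Integrable (fc s c) (nuMeas s) ∧
    ∫ x, fc s c x ∂(nuMeas s) =
      (√s + Real.exp (-|c|)) / (√s + Real.exp (-c)) := by
  have hr := one_le_sqrt_natCast hs
  set r : ℝ := √(s : ℝ) with hr_def
  have hsq : r ^ 2 = s := Real.sq_sqrt (by positivity)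
  set t := Real.exp (-|c|) with ht_def
  have ht : |t| ≤ 1 := by
    rw [abs_of_pos (Real.exp_pos _), Real.exp_le_one_iff]
    simp
  have hcauchy := integral_semicircle_cauchy r (Real.exp_pos (-|c|)).ne' ht
  have hν := integral_nuDensity hs
  set x₀ := Real.exp c + Real.exp (-c) + r with hx₀_def
  have hx₀ : r + t + 1 / t = x₀ := by
    have := exp_neg_abs_add_inv c
    linarith
  have hprod : r * x₀ + 1 = (r + Real.exp c) * (r + Real.exp (-c)) := by
    have : Real.exp c * Real.exp (-c) = 1 := by rw [← Real.exp_add]; simp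
    linear_combination -this
  rw [← ht_def, hx₀] at hcauchy
  have hc := Real.exp_pos c
  have hc' := Real.exp_pos (-c)
  have hpos : 0 < r * x₀ + 1 := by rw [hprod]; positivity
  set A := (Real.exp c + r) / (r * x₀ + 1) with hA
  have hae : (fun x => nuDensity s x * fc s c x) =ᵐ[volume.restrict {x | |x - r| ≤ 2}]
      fun x => A * (r * nuDensity s x +
        1 / (2 * Real.pi) * (√(4 - (x - r) ^ 2) * (x₀ - x)⁻¹)) := by
    filter_upwards [Measure.ae_ne _ (-1 / r), Measure.ae_ne _ x₀] with x h₁ h₂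
    have h₁' : x * r + 1 ≠ 0 := fun h => h₁ (by field_simp; linarith)
    have h₂' : x₀ - x ≠ 0 := sub_ne_zero.2 h₂.symm
    simp only [nuDensity, fc, ← hr_def, ← hx₀_def, hA]
    field_simp
    ring
  have hint := (((hν.1.const_mul r).add (hcauchy.1.const_mul (1 / (2 * Real.pi)))).const_mul A)
  have h := integrable_nuMeas hs (h := fc s c) (hint.congr hae.symm)
  refine ⟨h.1, h.2.trans ?_⟩
  rw [integral_congr_ae hae, integral_const_mul, integral_add (hν.1.const_mul r)
    (hcauchy.1.const_mul (1 / (2 * Real.pi))), integral_const_mul, integral_const_mul,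
    hν.2, hcauchy.2, fc, ← hr_def, ← hx₀_def, hA, ← hsq]
  have hne : x₀ - -1 / r = (r * x₀ + 1) / r := by field_simp; ring
  rw [hne, hprod]
  field_simp
  ring

theorem fc_nonneg_ae {s : ℕ} (hs : 1 ≤ s) (c : ℝ) : ∀ᵐ x ∂(nuMeas s), 0 ≤ fc s c x := by
  have hr := one_le_sqrt_natCast hs
  have hx₀ := two_le_exp_add_exp_neg c
  have hc := Real.exp_pos c
  refine ae_nuMeas s (ae_of_all _ fun x hx => ?_) ?_
  · exact div_nonneg (by linarith) (by linarith [(abs_le.1 hx).2])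
  · refine div_nonneg (by linarith) ?_
    rw [neg_div, sub_neg_eq_add]
    positivity

theorem isProbabilityMeasure_etaMeas {s : ℕ} (hs : 1 ≤ s) (c : ℝ) :
    IsProbabilityMeasure (etaMeas s c) := by
  have hf := integral_fc hs c
  have hr := one_le_sqrt_natCast hs
  have hc := Real.exp_pos (-c)
  constructor
  rw [etaMeas, Measure.add_apply, withDensity_apply _ MeasurableSet.univ, Measure.restrict_univ,
    ← ofReal_integral_eq_lintegral_ofReal hf.1 (fc_nonneg_ae hs c), hf.2, Measure.smul_apply,
    Measure.dirac_apply_of_mem (Set.mem_univ _), smul_eq_mul, mul_one]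
  split_ifs with hneg
  · have hle : Real.exp c ≤ Real.exp (-c) := Real.exp_le_exp.2 (by linarith)
    rw [abs_of_neg hneg, neg_neg, ← ENNReal.ofReal_add (by positivity)
      (div_nonneg (by linarith) (by positivity))]
    rw [ENNReal.ofReal_eq_one]
    field_simp
    ring
  · rw [abs_of_nonneg (not_lt.1 hneg), div_self (by positivity)]
    simp

theorem integrable_eval_of_ae_bounded {μ : Measure ℝ} [IsFiniteMeasure μ] {M : ℝ}
    (hμ : ∀ᵐ x ∂μ, |x| ≤ M) (p : Polynomial ℝ) : Integrable (fun x => p.eval x) μ := by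
  obtain ⟨C, hC⟩ := (isCompact_Icc (a := -M) (b := M)).exists_bound_of_continuousOn
    p.continuous.continuousOn
  refine Integrable.of_bound p.continuous.aestronglyMeasurable C ?_
  filter_upwards [hμ] with x hx using hC x (abs_le.1 hx)

theorem ae_nuMeas_abs_le {s : ℕ} (hs : 1 ≤ s) : ∀ᵐ x ∂(nuMeas s), |x| ≤ √s + 2 := by
  have hr := one_le_sqrt_natCast hs
  refine ae_nuMeas s (ae_of_all _ fun x hx => ?_) ?_
  · rw [abs_le] at *
    constructor <;> linarith [hx.1, hx.2]
  · rw [abs_div, abs_neg, abs_one, abs_of_pos (by linarith), div_le_iff₀ (by linarith)]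
    nlinarith

theorem integrable_eval_nuMeas {s : ℕ} (hs : 1 ≤ s) (p : Polynomial ℝ) :
    Integrable (fun x => p.eval x) (nuMeas s) :=
  have := isFiniteMeasure_nuMeas hs
  integrable_eval_of_ae_bounded (ae_nuMeas_abs_le hs) p

theorem integrable_eval_etaMeas {s : ℕ} (hs : 1 ≤ s) (c : ℝ) (p : Polynomial ℝ) :
    Integrable (fun x => p.eval x) (etaMeas s c) := by
  have := isProbabilityMeasure_etaMeas hs c
  have hr := one_le_sqrt_natCast hs
  have hx₀ := two_le_exp_add_exp_neg c
  refine integrable_eval_of_ae_bounded (M := Real.exp c + √s + Real.exp (-c)) ?_ p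
  rw [etaMeas, ae_add_measure_iff]
  constructor
  · refine (withDensity_absolutelyContinuous _ _).ae_le ?_
    filter_upwards [ae_nuMeas_abs_le hs] with x hx
    linarith
  · refine Measure.ae_smul_measure ?_ _
    rw [ae_dirac_eq]
    change |Real.exp c + √s + Real.exp (-c)| ≤ _
    exact (abs_of_nonneg (by positivity)).le

theorem integral_nuMeas_weighted_Qpoly {s : ℕ} (hs : 1 ≤ s) (n : ℕ) :
    ∫ x, (x * √s + 1) * (Qpoly s n).eval x ∂(nuMeas s) =
      (if n = 0 then 1 else 0) + √s * if n = 1 then 1 else 0 := by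
  have hr := one_le_sqrt_natCast hs
  have hae : (fun x => nuDensity s x * ((x * √s + 1) * (Qpoly s n).eval x))
      =ᵐ[volume.restrict {x | |x - √s| ≤ 2}]
      fun x => 1 / (2 * Real.pi) * (√(4 - (x - √s) ^ 2) * (Qpoly s n).eval x) := by
    filter_upwards [Measure.ae_ne _ (-1 / √(s : ℝ))] with x h₁
    have h₁' : x * √s + 1 ≠ 0 := fun h => h₁ (by field_simp; linarith)
    simp only [nuDensity]
    field_simp
  have hcont : IntegrableOn (fun x => 1 / (2 * Real.pi) *
      (√(4 - (x - √s) ^ 2) * (Qpoly s n).eval x)) {x | |x - √s| ≤ 2} := by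
    have hset : {x : ℝ | |x - √s| ≤ 2} = Metric.closedBall √(s : ℝ) 2 := by
      ext x
      simp [Real.dist_eq]
    rw [hset]
    refine ContinuousOn.integrableOn_compact (isCompact_closedBall _ _) ?_
    have := (Qpoly s n).continuous
    fun_prop
  rw [(integrable_nuMeas hs (hcont.congr hae.symm)).2, integral_congr_ae hae, integral_const_mul,
    integral_semicircle_Qpoly]
  have hz : -1 / √(s : ℝ) * √s + 1 = 0 := by field_simp; ring
  rw [hz, zero_mul, mul_zero, add_zero]
  field_simp

theorem integral_nuMeas_Qpoly {s : ℕ} (hs : 1 ≤ s) (n : ℕ) :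
    ∫ x, (Qpoly s n).eval x ∂(nuMeas s) = if n = 0 then 1 else 0 := by
  have hr := one_le_sqrt_natCast hs
  have hr₀ : √(s : ℝ) ≠ 0 := by linarith
  have hQ := fun n => integrable_eval_nuMeas hs (Qpoly s n)
  have h₀ : ∫ x, (Qpoly s 0).eval x ∂(nuMeas s) = 1 := by
    simpa [Qpoly] using (integral_nuMeas_one hs).2
  have h₁ : ∫ x, (Qpoly s 1).eval x ∂(nuMeas s) = 0 := by
    have h := integral_nuMeas_weighted_Qpoly hs 0
    have e : ∀ x, (x * √s + 1) * (Qpoly s 0).eval x =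
        √s * (Qpoly s 1).eval x + (Qpoly s 0).eval x := fun x => by
      simp [Qpoly]
      ring
    simp only [e] at h
    rw [integral_add ((hQ 1).const_mul _) (hQ 0), integral_const_mul, h₀] at h
    simpa [hr₀] using h
  have hstep : ∀ n, √s * (∫ x, (Qpoly s (n + 2)).eval x ∂(nuMeas s)) +
      (√s ^ 2 + 1) * (∫ x, (Qpoly s (n + 1)).eval x ∂(nuMeas s)) +
      √s * (∫ x, (Qpoly s n).eval x ∂(nuMeas s)) = √s * if n = 0 then 1 else 0 := by
    intro n
    have h := integral_nuMeas_weighted_Qpoly hs (n + 1)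
    have e : ∀ x, (x * √s + 1) * (Qpoly s (n + 1)).eval x =
        √s * (Qpoly s (n + 2)).eval x + (√s ^ 2 + 1) * (Qpoly s (n + 1)).eval x +
          √s * (Qpoly s n).eval x := fun x => by
      simp only [Qpoly, eval_sub, eval_mul, eval_X, eval_C]
      ring
    simp only [e] at h
    rw [integral_add (((hQ _).const_mul _).fun_add ((hQ _).const_mul _)) ((hQ _).const_mul _),
      integral_add ((hQ _).const_mul _) ((hQ _).const_mul _), integral_const_mul,
      integral_const_mul, integral_const_mul] at h
    simpa using h
  induction n using Nat.twoStepInduction with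
  | zero => simpa using h₀
  | one => simpa using h₁
  | more n ih₀ ih₁ =>
    have h := hstep n
    rw [ih₀, ih₁] at h
    simpa [hr₀] using h

theorem integral_etaMeas_weighted_Qpoly {s : ℕ} (hs : 1 ≤ s) (c : ℝ) (n : ℕ) :
    ∫ x, (Real.exp c + √s + Real.exp (-c) - x) * (Qpoly s n).eval x ∂(etaMeas s c) =
      (Real.exp c + √s) * if n = 0 then 1 else 0 := by
  have hr := one_le_sqrt_natCast hs
  have hx₀ := two_le_exp_add_exp_neg c
  set x₀ := Real.exp c + √s + Real.exp (-c) with hx₀_def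
  have hint : Integrable (fun x => (x₀ - x) * (Qpoly s n).eval x) (etaMeas s c) := by
    have h := integrable_eval_etaMeas hs c ((C x₀ - X) * Qpoly s n)
    simp only [eval_mul, eval_sub, eval_C, eval_X] at h
    exact h
  have hmeas : Measurable fun x => ENNReal.ofReal (fc s c x) := by
    unfold fc
    fun_prop
  rw [etaMeas] at hint ⊢
  rw [integrable_add_measure] at hint
  have hne : ∀ᵐ x ∂(nuMeas s), x ≠ x₀ := by
    refine ae_nuMeas s ((Measure.ae_ne _ x₀).mono fun x hx _ => hx) ?_
    refine ne_of_lt (lt_trans (b := 0) ?_ (by positivity))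
    exact div_neg_of_neg_of_pos (by norm_num) (by linarith)
  have hae : (fun x => (ENNReal.ofReal (fc s c x)).toReal • ((x₀ - x) * (Qpoly s n).eval x))
      =ᵐ[nuMeas s] fun x => (Real.exp c + √s) * (Qpoly s n).eval x := by
    filter_upwards [hne, fc_nonneg_ae hs c] with x hx hf
    have hsub : x₀ - x ≠ 0 := sub_ne_zero.2 hx.symm
    rw [ENNReal.toReal_ofReal hf, smul_eq_mul, fc,
      show Real.exp c + Real.exp (-c) + √s - x = x₀ - x by rw [hx₀_def]; ring]
    field_simp
  rw [integral_add_measure hint.1 hint.2, integral_withDensity_eq_integral_toReal_smul hmeas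
    (ae_of_all _ fun _ => ENNReal.ofReal_lt_top), integral_congr_ae hae, integral_const_mul,
    integral_nuMeas_Qpoly hs, integral_smul_measure, integral_dirac]
  simp [hx₀_def]

/-- `η_c^s` is a Borel probability measure and `∫ Q_n^s dη_c^s = e^{-cn}`. -/
theorem stmt0 (s : ℕ) (hs : 1 ≤ s) (c : ℝ) :
    IsProbabilityMeasure (etaMeas s c) ∧
    ∀ n : ℕ, ∫ x, (Qpoly s n).eval x ∂(etaMeas s c) = Real.exp (-(c * n)) := by
  have hprob := isProbabilityMeasure_etaMeas hs c
  refine ⟨hprob, fun n => ?_⟩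
  have hQ := fun n => integrable_eval_etaMeas hs c (Qpoly s n)
  have h₀ : ∫ x, (Qpoly s 0).eval x ∂(etaMeas s c) = 1 := by
    simp [Qpoly]
  have h₁ : ∫ x, (Qpoly s 1).eval x ∂(etaMeas s c) = Real.exp (-c) := by
    have h := integral_etaMeas_weighted_Qpoly hs c 0
    have e : ∀ x, (Real.exp c + √s + Real.exp (-c) - x) * (Qpoly s 0).eval x =
        (Real.exp c + √s + Real.exp (-c)) * (Qpoly s 0).eval x - (Qpoly s 1).eval x := fun x => by
      simp [Qpoly]
    simp only [e] at h
    rw [integral_sub ((hQ 0).const_mul _) (hQ 1), integral_const_mul, h₀] at h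
    simp only [if_true] at h
    linarith
  have hstep : ∀ n, ∫ x, (Qpoly s (n + 2)).eval x ∂(etaMeas s c) =
      (Real.exp c + Real.exp (-c)) * (∫ x, (Qpoly s (n + 1)).eval x ∂(etaMeas s c)) -
      ∫ x, (Qpoly s n).eval x ∂(etaMeas s c) := by
    intro n
    have h := integral_etaMeas_weighted_Qpoly hs c (n + 1)
    have e : ∀ x, (Real.exp c + √s + Real.exp (-c) - x) * (Qpoly s (n + 1)).eval x =
        (Real.exp c + Real.exp (-c)) * (Qpoly s (n + 1)).eval x -
          (Qpoly s n).eval x - (Qpoly s (n + 2)).eval x := fun x => by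
      simp only [Qpoly, eval_sub, eval_mul, eval_X, eval_C]
      ring
    simp only [e] at h
    rw [integral_sub (((hQ _).const_mul _).sub' (hQ _)) (hQ _),
      integral_sub ((hQ _).const_mul _) (hQ _), integral_const_mul] at h
    simp only [Nat.add_eq_zero_iff, one_ne_zero, and_false, if_false, mul_zero] at h
    linarith
  induction n using Nat.twoStepInduction with
  | zero => simpa using h₀
  | one => simpa using h₁
  | more n ih₀ ih₁ =>
    rw [hstep, ih₀, ih₁, add_mul, ← Real.exp_add, ← Real.exp_add]
    push_cast
    ring_nf
end

section
/- For every integer s ≥ 1, the polynomials (Q_n^s)_{n∈ℕ} form an orthonormal family in L²(ν_s): for all n, m ∈ ℕ, ∫ Q_n^s·Q_m^s dν_s equals 1 if n = m and 0 otherwise. -/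
open MeasureTheory Polynomial Filter

open Chebyshev in
theorem integral_eval_S_mul_sqrt (n : ℕ) :
    ∫ t in (-2 : ℝ)..2, (S ℝ n).eval t * √(4 - t ^ 2) = if n = 0 then 2 * Real.pi else 0 := by
  have hscale := intervalIntegral.mul_integral_comp_mul_left (a := -1) (b := 1)
    (f := fun t : ℝ => (S ℝ n).eval t * √(4 - t ^ 2)) (2 : ℝ)
  norm_num at hscale
  rw [← hscale]
  have hpoly : (1 - X ^ 2) * U ℝ n = Polynomial.C (1 / 2) * (T ℝ n - T ℝ (n + 2)) := by
    have h1 := one_sub_X_sq_mul_U_eq_pol_in_T ℝ (n : ℤ)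
    have h2 := T_add_two ℝ (n : ℤ)
    have h3 : (Polynomial.C (1 / 2) : ℝ[X]) * 2 = 1 := by
      rw [show (2 : ℝ[X]) = Polynomial.C 2 from rfl, ← Polynomial.C_mul]; norm_num
    linear_combination h1 - Polynomial.C (1 / 2) * h2 - (X * T ℝ ((n : ℤ) + 1) - T ℝ ((n : ℤ) + 2)) * h3
  have hfun : ∀ x ∈ Set.uIcc (-1 : ℝ) 1,
      (S ℝ n).eval (2 * x) * √(4 - (2 * x) ^ 2) =
        ((T ℝ n).eval x - (T ℝ (n + 2)).eval x) * √(1 - x ^ 2)⁻¹ := by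
    intro x hx
    have hS : (S ℝ n).eval (2 * x) = (U ℝ n).eval x := by
      rw [← S_comp_two_mul_X]; simp
    have hx' : 0 ≤ 1 - x ^ 2 := by
      rw [Set.uIcc_of_le (by norm_num)] at hx; nlinarith [hx.1, hx.2]
    have h := congrArg (eval x) hpoly
    simp only [eval_mul, eval_sub, eval_one, eval_pow, eval_X, eval_C] at h
    have hdiff : (T ℝ n).eval x - (T ℝ (n + 2)).eval x = 2 * ((1 - x ^ 2) * (U ℝ n).eval x) := by
      linarith
    rw [hS, hdiff, show 4 - (2 * x) ^ 2 = 2 ^ 2 * (1 - x ^ 2) by ring, Real.sqrt_mul (by norm_num),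
      Real.sqrt_sq (by norm_num), Real.sqrt_inv]
    rcases hx'.eq_or_lt with h0 | h0
    · simp [← h0]
    · have hne : √(1 - x ^ 2) ≠ 0 := (Real.sqrt_pos.2 h0).ne'
      field_simp
      rw [Real.sq_sqrt hx']
  rw [intervalIntegral.integral_congr hfun, ← integral_measureT
    (fun x => (T ℝ n).eval x - (T ℝ (n + 2)).eval x),
    integral_sub (integrable_measureT (by fun_prop)) (integrable_measureT (by fun_prop)),
    integral_eval_T_real_measureT_of_ne_zero (n := (n : ℤ) + 2) (by omega)]
  split_ifs with h
  · subst h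
    rw [Nat.cast_zero, integral_eval_T_real_measureT_zero, sub_zero]
  · rw [integral_eval_T_real_measureT_of_ne_zero (by exact_mod_cast h)]; simp

theorem hasDerivAt_sqrt_add_arcsin {r t : ℝ} (hr : r ≠ 0) (ht : t ∈ Set.Ioo (-2 : ℝ) 2) :
    HasDerivAt (fun t => √(4 - t ^ 2) / r + (r ^ 2 + 1) / r ^ 2 * Real.arcsin (t / 2))
      ((r ^ 2 + 1 - r * t) / (r ^ 2 * √(4 - t ^ 2))) t := by
  have h4 : 0 < 4 - t ^ 2 := by nlinarith [ht.1, ht.2]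
  have h1 : HasDerivAt (fun t : ℝ => √(4 - t ^ 2)) (-(2 * t) / (2 * √(4 - t ^ 2))) t := by
    simpa using ((hasDerivAt_pow 2 t).const_sub 4).sqrt h4.ne'
  have h2 := (Real.hasDerivAt_arcsin (x := t / 2) (by linarith [ht.1]) (by linarith [ht.2])).comp t
    ((hasDerivAt_id t).div_const 2)
  have hs : √(1 - (t / 2) ^ 2) = √(4 - t ^ 2) / 2 := by
    rw [show 1 - (t / 2) ^ 2 = (4 - t ^ 2) / 2 ^ 2 by ring, Real.sqrt_div' _ (by norm_num),
      Real.sqrt_sq (by norm_num)]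
  rw [hs] at h2
  refine ((h1.div_const r).add (h2.const_mul ((r ^ 2 + 1) / r ^ 2))).congr_deriv ?_
  have hne : √(4 - t ^ 2) ≠ 0 := (Real.sqrt_pos.2 h4).ne'
  field_simp
  ring

theorem hasDerivAt_arcsin_moebius {r t : ℝ} (hr : 1 < r) (ht : t ∈ Set.Ioo (-2 : ℝ) 2) :
    HasDerivAt (fun t => Real.arcsin (((r ^ 2 + 1) * t + 4 * r) / (2 * (r ^ 2 + 1 + r * t))))
      ((r ^ 2 - 1) / ((r ^ 2 + 1 + r * t) * √(4 - t ^ 2))) t := by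
  have h4 : 0 < 4 - t ^ 2 := by nlinarith [ht.1, ht.2]
  have hd : 0 < r ^ 2 + 1 + r * t := by nlinarith [ht.1, sq_nonneg (r - 1)]
  have hk : 0 < r ^ 2 - 1 := by nlinarith
  have hsq : 1 - (((r ^ 2 + 1) * t + 4 * r) / (2 * (r ^ 2 + 1 + r * t))) ^ 2 =
      ((r ^ 2 - 1) ^ 2 * (4 - t ^ 2)) / (2 * (r ^ 2 + 1 + r * t)) ^ 2 := by
    field_simp
    ring
  have hpos : 0 < 1 - (((r ^ 2 + 1) * t + 4 * r) / (2 * (r ^ 2 + 1 + r * t))) ^ 2 := by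
    rw [hsq]; positivity
  have h1 : HasDerivAt (fun t => ((r ^ 2 + 1) * t + 4 * r) / (2 * (r ^ 2 + 1 + r * t)))
      ((r ^ 2 - 1) ^ 2 / (2 * (r ^ 2 + 1 + r * t) ^ 2)) t := by
    refine ((((hasDerivAt_id t).const_mul (r ^ 2 + 1)).add_const (4 * r)).div
      ((((hasDerivAt_id t).const_mul r).const_add (r ^ 2 + 1)).const_mul 2)
      (by simp only [id]; positivity)).congr_deriv ?_
    simp only [id]
    field_simp
    ring
  have hs : √(1 - (((r ^ 2 + 1) * t + 4 * r) / (2 * (r ^ 2 + 1 + r * t))) ^ 2) =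
      (r ^ 2 - 1) * √(4 - t ^ 2) / (2 * (r ^ 2 + 1 + r * t)) := by
    rw [hsq, Real.sqrt_div' _ (by positivity), Real.sqrt_sq (by positivity),
      Real.sqrt_mul (by positivity), Real.sqrt_sq hk.le]
  refine ((Real.hasDerivAt_arcsin (fun h => ?_) (fun h => ?_)).comp t h1).congr_deriv ?_
  · rw [h] at hpos; norm_num at hpos
  · rw [h] at hpos; norm_num at hpos
  · rw [hs]
    have hne : √(4 - t ^ 2) ≠ 0 := (Real.sqrt_pos.2 h4).ne'
    field_simp

theorem integral_sqrt_div {r : ℝ} (hr : 1 ≤ r) :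
    IntervalIntegrable (fun t => √(4 - t ^ 2) / (r ^ 2 + 1 + r * t)) volume (-2) 2 ∧
      ∫ t in (-2 : ℝ)..2, √(4 - t ^ 2) / (r ^ 2 + 1 + r * t) = 2 * Real.pi / r ^ 2 := by
  have hr0 : 0 < r := by linarith
  obtain ⟨F, hcont, hderiv, hval⟩ : ∃ F : ℝ → ℝ, ContinuousOn F (Set.Icc (-2) 2) ∧
      (∀ t ∈ Set.Ioo (-2 : ℝ) 2, HasDerivAt F (√(4 - t ^ 2) / (r ^ 2 + 1 + r * t)) t) ∧
      F 2 - F (-2) = 2 * Real.pi / r ^ 2 := by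
    rcases hr.eq_or_lt with rfl | hr1
    · refine ⟨_, Continuous.continuousOn ?_, fun t ht =>
        (hasDerivAt_sqrt_add_arcsin one_ne_zero ht).congr_deriv ?_, ?_⟩
      · fun_prop
      · have h4 : 0 < 4 - t ^ 2 := by nlinarith [ht.1, ht.2]
        have hne : √(4 - t ^ 2) ≠ 0 := (Real.sqrt_pos.2 h4).ne'
        have hd : 2 + t ≠ 0 := by linarith [ht.1]
        rw [show (1 : ℝ) ^ 2 + 1 + 1 * t = 2 + t by ring]
        field_simp
        rw [Real.sq_sqrt h4.le]
        ring
      · norm_num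
        ring
    · refine ⟨fun t => (√(4 - t ^ 2) / r + (r ^ 2 + 1) / r ^ 2 * Real.arcsin (t / 2)) -
        (r ^ 2 - 1) / r ^ 2 *
          Real.arcsin (((r ^ 2 + 1) * t + 4 * r) / (2 * (r ^ 2 + 1 + r * t))), ?_, fun t ht =>
        ((hasDerivAt_sqrt_add_arcsin hr0.ne' ht).sub
          ((hasDerivAt_arcsin_moebius hr1 ht).const_mul _)).congr_deriv ?_, ?_⟩
      · refine ContinuousOn.sub (by fun_prop) (ContinuousOn.mul (by fun_prop)
          (Real.continuous_arcsin.comp_continuousOn (ContinuousOn.div (by fun_prop) (by fun_prop)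
            fun t ht => ?_)))
        have : 0 < r ^ 2 + 1 + r * t := by nlinarith [ht.1, sq_pos_of_pos (sub_pos.2 hr1)]
        positivity
      · have h4 : 0 < 4 - t ^ 2 := by nlinarith [ht.1, ht.2]
        have hne : √(4 - t ^ 2) ≠ 0 := (Real.sqrt_pos.2 h4).ne'
        have hd : 0 < r ^ 2 + 1 + r * t := by nlinarith [ht.1, sq_nonneg (r - 1)]
        field_simp
        rw [Real.sq_sqrt h4.le]
        ring
      · have h1 : ((r ^ 2 + 1) * 2 + 4 * r) / (2 * (r ^ 2 + 1 + r * 2)) = 1 := by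
          rw [div_eq_one_iff_eq (by positivity)]; ring
        have h2 : ((r ^ 2 + 1) * (-2) + 4 * r) / (2 * (r ^ 2 + 1 + r * (-2))) = -1 := by
          have : 0 < r ^ 2 + 1 + r * (-2) := by nlinarith [sq_pos_of_pos (sub_pos.2 hr1)]
          rw [div_eq_iff (by positivity)]; ring
        simp only [h1, h2]
        norm_num
        field_simp
        ring
  have hInt : IntervalIntegrable (fun t => √(4 - t ^ 2) / (r ^ 2 + 1 + r * t)) volume (-2) 2 := by
    rw [intervalIntegrable_iff_integrableOn_Ioc_of_le (by norm_num)]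
    refine intervalIntegral.integrableOn_deriv_of_nonneg hcont hderiv fun t ht => ?_
    have : 0 < r ^ 2 + 1 + r * t := by nlinarith [ht.1, sq_nonneg (r - 1)]
    positivity
  exact ⟨hInt, by
    rw [intervalIntegral.integral_eq_sub_of_hasDerivAt_of_le (by norm_num) hcont hderiv hInt, hval]⟩

theorem S_comp_X_sub_C_eq_Qpoly (s n : ℕ) :
    Qpoly s n = (Chebyshev.S ℝ n).comp (X - C √s) +
      C √s * (Chebyshev.S ℝ ((n : ℤ) - 1)).comp (X - C √s) := by
  induction n using Nat.twoStepInduction with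
  | zero => simp [Qpoly]
  | one => simp [Qpoly]
  | more n ih1 ih2 =>
    have h1 := congrArg (fun p : ℝ[X] => p.comp (X - C √s)) (Chebyshev.S_add_two ℝ (n : ℤ))
    have h2 := congrArg (fun p : ℝ[X] => p.comp (X - C √s)) (Chebyshev.S_add_one ℝ (n : ℤ))
    simp only [sub_comp, mul_comp, X_comp] at h1 h2
    rw [Qpoly, ih1, ih2]
    push_cast
    rw [show (n : ℤ) + 2 - 1 = n + 1 by ring, show (n : ℤ) + 1 - 1 = n by ring]
    linear_combination -h1 - C √s * h2

theorem C_mul_Qpoly_succ_add_Qpoly (s n : ℕ) :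
    C √s * Qpoly s (n + 1) + Qpoly s n =
      (X * C √s + 1) * (Chebyshev.S ℝ n).comp (X - C √s) := by
  have h := congrArg (fun p : ℝ[X] => p.comp (X - C √s)) (Chebyshev.S_add_one ℝ (n : ℤ))
  simp only [sub_comp, mul_comp, X_comp] at h
  rw [S_comp_X_sub_C_eq_Qpoly s n, S_comp_X_sub_C_eq_Qpoly s (n + 1)]
  push_cast
  rw [show (n : ℤ) + 1 - 1 = n by ring]
  linear_combination C √s * h

theorem integrable_and_integral_nuMeas (s : ℕ) (hs : 1 ≤ s) {f : ℝ → ℝ} (hf : Continuous f) :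
    Integrable f (nuMeas s) ∧
      ∫ x, f x ∂(nuMeas s) = (∫ t in (-2 : ℝ)..2,
        √(4 - t ^ 2) / (√s ^ 2 + 1 + √s * t) * f (t + √s)) / (2 * Real.pi)
          + (1 - 1 / (s : ℝ)) * f (-1 / √s) := by
  have hs' : (1 : ℝ) ≤ s := by exact_mod_cast hs
  have hr : 1 ≤ √(s : ℝ) := Real.one_le_sqrt.2 hs'
  set r := √(s : ℝ) with hr_def
  set d : ℝ → ℝ := fun x => if |x - r| ≤ 2 then nuDensity s x else 0 with hd
  have hd0 : 0 ≤ d := by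
    intro x
    simp only [hd, nuDensity, Pi.zero_apply]
    split_ifs with h
    · have : 0 ≤ x * r + 1 := by nlinarith [(abs_le.1 h).1, sq_nonneg (r - 1)]
      positivity
    · rfl
  have hdm : Measurable d := by
    refine Measurable.ite (measurableSet_le (by fun_prop) (by fun_prop)) ?_ measurable_const
    unfold nuDensity
    fun_prop
  have hprod : (fun x => d x * f x) = (Set.Icc (r - 2) (r + 2)).indicator
      (fun x => (2 * Real.pi)⁻¹ *
        (√(4 - (x - r) ^ 2) / (r ^ 2 + 1 + r * (x - r)) * f (x - r + r))) := by
    funext x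
    have hiff : |x - r| ≤ 2 ↔ x ∈ Set.Icc (r - 2) (r + 2) := by
      rw [abs_le, Set.mem_Icc]; constructor <;> rintro ⟨h1, h2⟩ <;> constructor <;> linarith
    by_cases h : x ∈ Set.Icc (r - 2) (r + 2)
    · rw [Set.indicator_of_mem h]
      simp only [hd, if_pos (hiff.2 h), nuDensity, ← hr_def]
      rw [show r ^ 2 + 1 + r * (x - r) = x * r + 1 by ring, sub_add_cancel, mul_comm (2 * Real.pi),
        ← div_div]
      ring
    · rw [Set.indicator_of_notMem h]
      simp [hd, if_neg (mt hiff.1 h)]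
  have hI : IntervalIntegrable (fun t => √(4 - t ^ 2) / (r ^ 2 + 1 + r * t) * f (t + r))
      volume (-2) 2 :=
    (integral_sqrt_div hr).1.mul_continuousOn (by fun_prop)
  have hI' := (hI.comp_sub_right r).const_mul (2 * Real.pi)⁻¹
  rw [intervalIntegrable_iff_integrableOn_Ioc_of_le (by linarith), ← integrableOn_Icc_iff_integrableOn_Ioc,
    show -2 + r = r - 2 by ring, add_comm 2 r] at hI'
  have hac : Integrable f (volume.withDensity fun x => ENNReal.ofReal (d x)) := by
    rw [integrable_withDensity_iff_integrable_smul' hdm.ennreal_ofReal (by simp)]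
    simp only [ENNReal.toReal_ofReal (hd0 _), smul_eq_mul]
    rw [hprod, integrable_indicator_iff measurableSet_Icc]
    exact hI'
  have hat : Integrable f (ENNReal.ofReal (1 - 1 / (s : ℝ)) • Measure.dirac (-1 / r)) :=
    (integrable_dirac (by simp)).smul_measure ENNReal.ofReal_ne_top
  refine ⟨hac.add_measure hat, ?_⟩
  have hatom : 0 ≤ 1 - 1 / (s : ℝ) := by
    rw [sub_nonneg, div_le_one (by linarith)]; exact hs'
  rw [nuMeas, integral_add_measure hac hat, integral_smul_measure, integral_dirac,
    ENNReal.toReal_ofReal hatom, smul_eq_mul,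
    integral_withDensity_eq_integral_toReal_smul hdm.ennreal_ofReal (by simp)]
  congr 1
  simp only [smul_eq_mul]
  simp_rw [ENNReal.toReal_ofReal (hd0 _)]
  rw [hprod, integral_indicator measurableSet_Icc, integral_Icc_eq_integral_Ioc,
    ← intervalIntegral.integral_of_le (by linarith), intervalIntegral.integral_const_mul,
    intervalIntegral.integral_comp_sub_right
      (fun t => √(4 - t ^ 2) / (r ^ 2 + 1 + r * t) * f (t + r)),
    show r - 2 - r = -2 by ring, show r + 2 - r = 2 by ring, inv_mul_eq_div]

theorem integral_eval_Qpoly_nuMeas (s : ℕ) (hs : 1 ≤ s) (n : ℕ) :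
    ∫ x, (Qpoly s n).eval x ∂(nuMeas s) = if n = 0 then 1 else 0 := by
  have hs' : (1 : ℝ) ≤ s := by exact_mod_cast hs
  have hr : 1 ≤ √(s : ℝ) := Real.one_le_sqrt.2 hs'
  have hr2 : √(s : ℝ) ^ 2 = s := Real.sq_sqrt (by linarith)
  have hπ := Real.pi_pos.ne'
  have hInt (p : ℝ[X]) : Integrable (fun x => p.eval x) (nuMeas s) :=
    (integrable_and_integral_nuMeas s hs p.continuous).1
  have hzero : ∫ x, (Qpoly s 0).eval x ∂(nuMeas s) = 1 := by
    simp only [Qpoly, eval_one]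
    rw [(integrable_and_integral_nuMeas s hs continuous_const).2]
    simp only [mul_one]
    rw [(integral_sqrt_div hr).2, hr2]
    field_simp
    ring
  have hrec (k : ℕ) : √(s : ℝ) * ∫ x, (Qpoly s (k + 1)).eval x ∂(nuMeas s) +
      ∫ x, (Qpoly s k).eval x ∂(nuMeas s) = if k = 0 then 1 else 0 := by
    rw [← integral_const_mul, ← integral_add ((hInt _).const_mul _) (hInt _)]
    have heval (x : ℝ) : √(s : ℝ) * (Qpoly s (k + 1)).eval x + (Qpoly s k).eval x =
        (x * √s + 1) * (Chebyshev.S ℝ k).eval (x - √s) := by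
      simpa [mul_comm x] using congrArg (eval x) (C_mul_Qpoly_succ_add_Qpoly s k)
    simp_rw [heval]
    rw [(integrable_and_integral_nuMeas s hs (by fun_prop)).2]
    have hcongr : ∫ t in (-2 : ℝ)..2, √(4 - t ^ 2) / (√s ^ 2 + 1 + √s * t) *
          (((t + √s) * √s + 1) * (Chebyshev.S ℝ k).eval (t + √s - √s)) =
        ∫ t in (-2 : ℝ)..2, (Chebyshev.S ℝ k).eval t * √(4 - t ^ 2) := by
      refine intervalIntegral.integral_congr_ae (ae_of_all _ fun t ht => ?_)
      rw [Set.uIoc_of_le (by norm_num)] at ht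
      have hd : 0 < √(s : ℝ) ^ 2 + 1 + √s * t := by
        nlinarith [ht.1, sq_nonneg (√(s : ℝ) - 1)]
      rw [add_sub_cancel_right, show (t + √s) * √s + 1 = √(s : ℝ) ^ 2 + 1 + √s * t by ring,
        ← mul_assoc, div_mul_cancel₀ _ hd.ne', mul_comm]
    rw [hcongr, integral_eval_S_mul_sqrt, show -1 / √(s : ℝ) * √s + 1 = 0 by field_simp; ring]
    split_ifs <;> simp [hπ]
  have hsucc (k : ℕ) : ∫ x, (Qpoly s (k + 1)).eval x ∂(nuMeas s) = 0 := by
    have hr0 : √(s : ℝ) ≠ 0 := by linarith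
    induction k with
    | zero => simpa [hzero, hr0] using hrec 0
    | succ k ih => simpa [ih, hr0] using hrec (k + 1)
  cases n with
  | zero => simpa using hzero
  | succ k => simpa using hsucc k

/-- The polynomials `Q_n^s` form an orthonormal family in `L²(ν_s)`. -/
theorem stmt4 (s : ℕ) (hs : 1 ≤ s) (n m : ℕ) :
    ∫ x, (Qpoly s n).eval x * (Qpoly s m).eval x ∂(nuMeas s) =
      if n = m then 1 else 0 := by
  have hInt (p : ℝ[X]) : Integrable (fun x => p.eval x) (nuMeas s) :=
    (integrable_and_integral_nuMeas s hs p.continuous).1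
  let Λ : ℝ[X] →ₗ[ℝ] ℝ :=
    { toFun := fun p => ∫ x, p.eval x ∂(nuMeas s)
      map_add' := fun p q => by
        simp only [eval_add]
        exact integral_add (hInt p) (hInt q)
      map_smul' := fun c p => by
        simp only [eval_smul, RingHom.id_apply]
        exact integral_smul c _ }
  have hΛ (k : ℕ) : Λ (Qpoly s k) = if k = 0 then 1 else 0 :=
    integral_eval_Qpoly_nuMeas s hs k
  have hX (k : ℕ) : X * Qpoly s (k + 1) =
      Qpoly s (k + 2) + √(s : ℝ) • Qpoly s (k + 1) + Qpoly s k := by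
    rw [Qpoly, smul_eq_C_mul]; ring
  suffices h : ∀ m n, Λ (Qpoly s n * Qpoly s m) = if n = m then 1 else 0 by
    simpa [Λ] using h m n
  intro m
  induction m using Nat.twoStepInduction with
  | zero => intro n; simpa [Qpoly] using hΛ n
  | one =>
    intro n
    cases n with
    | zero => simpa [Qpoly] using hΛ 1
    | succ k =>
      rw [show Qpoly s 1 = X from rfl, mul_comm, hX]
      simp [hΛ]
  | more m ih1 ih2 =>
    intro n
    have hexp : Qpoly s n * Qpoly s (m + 2) = (X * Qpoly s n) * Qpoly s (m + 1) -
        √(s : ℝ) • (Qpoly s n * Qpoly s (m + 1)) - Qpoly s n * Qpoly s m := by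
      rw [Qpoly, smul_eq_C_mul]; ring
    rw [hexp, map_sub, map_sub, map_smul, ih2, ih1]
    cases n with
    | zero =>
      rw [show X * Qpoly s 0 = Qpoly s 1 by simp [Qpoly], ih2]
      simp [eq_comm]
    | succ k =>
      rw [hX, add_mul, add_mul, smul_mul_assoc, map_add, map_add, map_smul, ih2, ih2, ih2]
      simp only [smul_eq_mul, Nat.add_right_cancel_iff]
      split_ifs <;> first | omega | simp
end

section
/- Let s ≥ 1 be an integer, c ∈ ℝ, and let μ be a compactly supported finite Borel measure on ℝ such that ∫ Q_n^s dμ ≤ e^{-cn} for all n ∈ ℕ. Then for every m ∈ ℕ, ∫ x^{2m} dμ(x) ≤ ∫ x^{2m} dη_c^s(x). -/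
open MeasureTheory Polynomial Filter

/-- The weight `sin² θ / (1 - 2 a cos θ + a²)`. -/
noncomputable def chebWeight (a θ : ℝ) : ℝ :=
  Real.sin θ ^ 2 / (1 - 2 * a * Real.cos θ + a ^ 2)

lemma chebWeight_denom_pos (a : ℝ) {θ : ℝ} (hθ : θ ∈ Set.Ioo 0 Real.pi) :
    0 < 1 - 2 * a * Real.cos θ + a ^ 2 := by
  have h1 := Real.sin_pos_of_mem_Ioo hθ
  have h2 := Real.sin_sq_add_cos_sq θ
  nlinarith [sq_nonneg (a - Real.cos θ), pow_pos h1 2]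

lemma integrableOn_chebWeight_mul (a : ℝ) {g : ℝ → ℝ} (hg : Continuous g) :
    IntegrableOn (fun θ => chebWeight a θ * g θ) (Set.Ioo 0 Real.pi) := by
  have hgi : IntegrableOn g (Set.Ioo 0 Real.pi) :=
    (hg.integrableOn_Icc (a := 0) (b := Real.pi)).mono_set Set.Ioo_subset_Icc_self
  refine Integrable.bdd_mul (c := 1) hgi ?_ ?_
  · exact (by unfold chebWeight; fun_prop : Measurable (chebWeight a)).aestronglyMeasurable
  · refine (ae_restrict_iff' measurableSet_Ioo).2 (ae_of_all _ fun θ hθ => ?_)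
    have hD := chebWeight_denom_pos a hθ
    rw [chebWeight, Real.norm_of_nonneg (by positivity), div_le_one hD]
    nlinarith [sq_nonneg (a - Real.cos θ), Real.sin_sq_add_cos_sq θ]

lemma integral_sin_mul_sin (n : ℕ) :
    ∫ θ in Set.Ioo 0 Real.pi, Real.sin θ * Real.sin ((n + 2) * θ) = 0 := by
  rw [← integral_Ioc_eq_integral_Ioo, ← intervalIntegral.integral_of_le Real.pi_pos.le]
  have h1 : (n : ℝ) + 1 ≠ 0 := by positivity
  have h3 : (n : ℝ) + 3 ≠ 0 := by positivity
  rw [intervalIntegral.integral_eq_sub_of_hasDerivAt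
    (f := fun θ => Real.sin ((n + 1) * θ) / (2 * (n + 1)) - Real.sin ((n + 3) * θ) / (2 * (n + 3)))]
  · have e1 : Real.sin (((n : ℝ) + 1) * Real.pi) = 0 := by
      exact_mod_cast Real.sin_nat_mul_pi (n + 1)
    have e3 : Real.sin (((n : ℝ) + 3) * Real.pi) = 0 := by
      exact_mod_cast Real.sin_nat_mul_pi (n + 3)
    simp [e1, e3]
  · intro θ _
    have d (k : ℝ) : HasDerivAt (fun θ => Real.sin (k * θ)) (Real.cos (k * θ) * k) θ := by
      simpa using ((hasDerivAt_id θ).const_mul k).sin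
    refine (((d (n + 1)).div_const (2 * ((n : ℝ) + 1))).sub
      ((d (n + 3)).div_const (2 * ((n : ℝ) + 3)))).congr_deriv ?_
    have e1 : ((n : ℝ) + 1) * θ = (n + 2) * θ - θ := by ring
    have e3 : ((n : ℝ) + 3) * θ = (n + 2) * θ + θ := by ring
    rw [e1, e3, Real.cos_sub, Real.cos_add]
    field_simp
    ring
  · exact Continuous.intervalIntegrable (by fun_prop) _ _

lemma integral_poisson {a : ℝ} (ha : |a| < 1) :
    ∫ θ in Set.Ioo 0 Real.pi, (1 - a ^ 2) / (1 - 2 * a * Real.cos θ + a ^ 2) = Real.pi := by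
  rw [← integral_Ioc_eq_integral_Ioo, ← intervalIntegral.integral_of_le Real.pi_pos.le]
  obtain ⟨hl, hu⟩ := abs_lt.1 ha
  have key (θ : ℝ) : 0 < 1 - a * Real.cos θ := by
    have h := abs_mul a (Real.cos θ)
    have h' : |a| * |Real.cos θ| ≤ |a| * 1 :=
      mul_le_mul_of_nonneg_left (Real.abs_cos_le_one θ) (abs_nonneg a)
    linarith [le_abs_self (a * Real.cos θ)]
  have hD (θ : ℝ) : 0 < 1 - 2 * a * Real.cos θ + a ^ 2 := by
    nlinarith [Real.sin_sq_add_cos_sq θ, sq_nonneg (a * Real.sin θ), pow_pos (key θ) 2]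
  rw [intervalIntegral.integral_eq_sub_of_hasDerivAt
    (f := fun θ => θ + 2 * Real.arctan (a * Real.sin θ / (1 - a * Real.cos θ)))]
  · simp
  · intro θ _
    have h := (hasDerivAt_id θ).add (((((Real.hasDerivAt_sin θ).const_mul a).div
      (((Real.hasDerivAt_cos θ).const_mul a).const_sub 1) (key θ).ne').arctan).const_mul 2)
    refine h.congr_deriv ?_
    have h1 := (hD θ).ne'
    have h2 := (key θ).ne'
    have e : (1 - a * Real.cos θ) ^ 2 + (a * Real.sin θ) ^ 2 = 1 - 2 * a * Real.cos θ + a ^ 2 := by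
      linear_combination a ^ 2 * Real.sin_sq_add_cos_sq θ
    have e' : 1 + (a * Real.sin θ / (1 - a * Real.cos θ)) ^ 2
        = (1 - 2 * a * Real.cos θ + a ^ 2) / (1 - a * Real.cos θ) ^ 2 := by
      rw [← e]; field_simp
    simp only [Pi.div_apply]
    rw [e']
    generalize hd : 1 - 2 * a * Real.cos θ + a ^ 2 = d at h1 e ⊢
    field_simp
    linear_combination (-1) * hd - 2 * a ^ 2 * Real.sin_sq_add_cos_sq θ
  · refine Continuous.intervalIntegrable ?_ _ _
    exact continuous_const.div (by fun_prop) fun θ => (hD θ).ne'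

lemma integral_chebWeight {a : ℝ} (ha0 : a ≠ 0) (ha : |a| ≤ 1) :
    ∫ θ in Set.Ioo 0 Real.pi, chebWeight a θ = Real.pi / 2 := by
  have hcos : ∫ θ in Set.Ioo 0 Real.pi, Real.cos θ = 0 := by
    rw [← integral_Ioc_eq_integral_Ioo, ← intervalIntegral.integral_of_le Real.pi_pos.le]
    simp
  have hci : IntegrableOn Real.cos (Set.Ioo 0 Real.pi) :=
    (Real.continuous_cos.integrableOn_Icc (a := 0) (b := Real.pi)).mono_set Set.Ioo_subset_Icc_self
  have hk (k : ℝ) : IntegrableOn (fun _ : ℝ => k) (Set.Ioo 0 Real.pi) :=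
    (continuous_const.integrableOn_Icc (a := 0) (b := Real.pi)).mono_set Set.Ioo_subset_Icc_self
  have hl : IntegrableOn (fun θ => (1 + a ^ 2) + 2 * a * Real.cos θ) (Set.Ioo 0 Real.pi) :=
    (hk _).add (hci.const_mul _)
  have hlin : ∫ θ in Set.Ioo 0 Real.pi, ((1 + a ^ 2) + 2 * a * Real.cos θ)
      = (1 + a ^ 2) * Real.pi := by
    rw [integral_add (hk _) (hci.const_mul _), integral_const_mul, hcos]
    simp [Real.pi_pos.le, mul_comm]
  have hP : ∫ θ in Set.Ioo 0 Real.pi,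
      (1 - a ^ 2) * ((1 - a ^ 2) / (1 - 2 * a * Real.cos θ + a ^ 2)) = (1 - a ^ 2) * Real.pi := by
    rcases ha.lt_or_eq with h | h
    · rw [integral_const_mul, integral_poisson h]
    · have : 1 - a ^ 2 = 0 := by rw [← sq_abs, h]; norm_num
      simp [this]
  have hW := integrableOn_chebWeight_mul a (g := fun _ => 4 * a ^ 2) continuous_const
  have hsum : ∫ θ in Set.Ioo 0 Real.pi, (((1 + a ^ 2) + 2 * a * Real.cos θ)
      - chebWeight a θ * (4 * a ^ 2)) = (1 - a ^ 2) * Real.pi := by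
    rw [← hP]
    refine setIntegral_congr_fun measurableSet_Ioo fun θ hθ => ?_
    have h1 := (chebWeight_denom_pos a hθ).ne'
    simp only [chebWeight]
    generalize hd : 1 - 2 * a * Real.cos θ + a ^ 2 = d at h1 ⊢
    field_simp
    linear_combination (-(1 + a ^ 2 + 2 * a * Real.cos θ)) * hd
      - 4 * a ^ 2 * Real.sin_sq_add_cos_sq θ
  rw [integral_sub (f := fun θ => (1 + a ^ 2) + 2 * a * Real.cos θ)
    hl hW, hlin, integral_mul_const] at hsum
  have : (4 * a ^ 2) ≠ 0 := by positivity
  apply mul_right_cancel₀ this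
  linear_combination -hsum

open Polynomial.Chebyshev in
lemma integral_chebWeight_mul_U {a : ℝ} (ha0 : a ≠ 0) (ha : |a| ≤ 1) (n : ℕ) :
    ∫ θ in Set.Ioo 0 Real.pi, chebWeight a θ * (U ℝ n).eval (Real.cos θ)
      = Real.pi / 2 * a ^ n := by
  have hint (p : ℝ[X]) : IntegrableOn (fun θ => chebWeight a θ * p.eval (Real.cos θ))
      (Set.Ioo 0 Real.pi) :=
    integrableOn_chebWeight_mul a (p.continuous.comp Real.continuous_cos)
  have hci {g : ℝ → ℝ} (hg : Continuous g) : IntegrableOn g (Set.Ioo 0 Real.pi) :=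
    (hg.integrableOn_Icc (a := 0) (b := Real.pi)).mono_set Set.Ioo_subset_Icc_self
  have rec_eq (k : ℤ) : a * ((∫ θ in Set.Ioo 0 Real.pi, chebWeight a θ * (U ℝ (k + 2)).eval (Real.cos θ))
      + ∫ θ in Set.Ioo 0 Real.pi, chebWeight a θ * (U ℝ k).eval (Real.cos θ))
      = (1 + a ^ 2) * (∫ θ in Set.Ioo 0 Real.pi, chebWeight a θ * (U ℝ (k + 1)).eval (Real.cos θ))
        - ∫ θ in Set.Ioo 0 Real.pi, Real.sin θ * Real.sin ((k + 2) * θ) := by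
    rw [← integral_add (hint _) (hint _), ← integral_const_mul, ← integral_const_mul,
      ← integral_sub ((hint _).const_mul _) (hci (by fun_prop))]
    refine setIntegral_congr_fun measurableSet_Ioo fun θ hθ => ?_
    have h1 := (chebWeight_denom_pos a hθ).ne'
    have h2 := U_real_cos θ (k + 1)
    have e : (((k + 1 : ℤ) : ℝ) + 1) * θ = (k + 2) * θ := by push_cast; ring
    rw [e] at h2
    simp only [chebWeight, U_add_two, ← h2, eval_sub, eval_mul, eval_X, eval_ofNat]
    generalize hd : 1 - 2 * a * Real.cos θ + a ^ 2 = d at h1 ⊢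
    field_simp
    linear_combination (-(U ℝ (k + 1)).eval (Real.cos θ) * Real.sin θ ^ 2) * hd
  induction n using Nat.twoStepInduction with
  | zero => simpa using integral_chebWeight ha0 ha
  | one =>
    have h := rec_eq (-1)
    have hs : ∫ θ in Set.Ioo 0 Real.pi, Real.sin θ * Real.sin (((-1 : ℤ) + 2) * θ) = Real.pi / 2 := by
      rw [← integral_Ioc_eq_integral_Ioo, ← intervalIntegral.integral_of_le Real.pi_pos.le]
      have := integral_sin_sq (a := 0) (b := Real.pi)
      simp only [Real.sin_zero, Real.sin_pi] at this
      norm_num [← sq, this]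
    rw [hs] at h
    norm_num [integral_chebWeight ha0 ha] at h ⊢
    apply mul_left_cancel₀ ha0
    linear_combination h
  | more k h1 h2 =>
    have h := rec_eq k
    have hs := integral_sin_mul_sin k
    simp only [Int.cast_natCast] at h
    rw [hs, h1] at h
    push_cast at h2 ⊢
    rw [h2] at h
    apply mul_left_cancel₀ ha0
    linear_combination h

open Polynomial.Chebyshev in
lemma eval_Qpoly_add_two_mul (s n : ℕ) (y : ℝ) :
    (Qpoly s n).eval (√s + 2 * y) = (U ℝ n).eval y + √s * (U ℝ (n - 1)).eval y := by
  induction n using Nat.twoStepInduction with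
  | zero => simp [Qpoly]
  | one => simp [Qpoly]; ring
  | more k h1 h2 =>
    have e1 : (((k + 2 : ℕ) : ℤ)) = (k : ℤ) + 2 := by push_cast; ring
    have e2 : (k : ℤ) + 2 - 1 = ((k : ℤ) - 1) + 2 := by ring
    have e3 : (k : ℤ) - 1 + 1 = k := by ring
    rw [e1, e2, U_add_two, U_add_two, e3]
    rw [show ((k + 1 : ℕ) : ℤ) = (k : ℤ) + 1 by push_cast; ring, add_sub_cancel_right] at h2
    simp only [Qpoly, eval_sub, eval_mul, eval_X, eval_C, eval_ofNat, h1, h2]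
    ring

lemma integral_chebWeight_mul_Qpoly_zero {a : ℝ} (ha0 : a ≠ 0) (ha : |a| ≤ 1) (s : ℕ) :
    ∫ θ in Set.Ioo 0 Real.pi, chebWeight a θ * (Qpoly s 0).eval (√s + 2 * Real.cos θ)
      = Real.pi / 2 := by
  simpa [Qpoly] using integral_chebWeight ha0 ha

lemma integral_chebWeight_mul_Qpoly_succ {a : ℝ} (ha0 : a ≠ 0) (ha : |a| ≤ 1) (s n : ℕ) :
    ∫ θ in Set.Ioo 0 Real.pi, chebWeight a θ * (Qpoly s (n + 1)).eval (√s + 2 * Real.cos θ)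
      = Real.pi / 2 * (a ^ (n + 1) + √s * a ^ n) := by
  have hint (p : ℝ[X]) : IntegrableOn (fun θ => chebWeight a θ * p.eval (Real.cos θ))
      (Set.Ioo 0 Real.pi) :=
    integrableOn_chebWeight_mul a (p.continuous.comp Real.continuous_cos)
  simp only [eval_Qpoly_add_two_mul, mul_add, mul_left_comm _ (√(s : ℝ))]
  rw [integral_add (hint _) ((hint _).const_mul _), integral_const_mul,
    integral_chebWeight_mul_U ha0 ha]
  push_cast
  rw [add_sub_cancel_right, integral_chebWeight_mul_U ha0 ha]

lemma eval_Qpoly_neg_one_div {s : ℕ} (hs : 1 ≤ s) (n : ℕ) :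
    (Qpoly s n).eval (-1 / √s) = (-1 / √s) ^ n := by
  have hr : √(s : ℝ) ≠ 0 := by positivity
  induction n using Nat.twoStepInduction with
  | zero => simp [Qpoly]
  | one => simp [Qpoly]
  | more k h1 h2 =>
    simp only [Qpoly, eval_sub, eval_mul, eval_X, eval_C, h1, h2]
    have h : -1 / √(s : ℝ) * √s = -1 := by field_simp
    generalize -1 / √(s : ℝ) = b at *
    linear_combination (-b ^ k) * h

lemma eval_Qpoly_mul_sub_inv (s n : ℕ) {q : ℝ} (hq : q ≠ 0) :
    (Qpoly s n).eval (q⁻¹ + √s + q) * (q - q⁻¹)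
      = (q ^ (n + 1) - q⁻¹ ^ (n + 1)) + √s * (q ^ n - q⁻¹ ^ n) := by
  induction n using Nat.twoStepInduction with
  | zero => simp [Qpoly]
  | one => simp [Qpoly]; ring
  | more k h1 h2 =>
    simp only [Qpoly, eval_sub, eval_mul, eval_X, eval_C]
    have h : q * q⁻¹ = 1 := mul_inv_cancel₀ hq
    generalize q⁻¹ = p at *
    linear_combination (q + p) * h2 - h1 + (q ^ (k + 1) - p ^ (k + 1) + √s * (q ^ k - p ^ k)) * h

lemma image_two_mul_cos (r : ℝ) :
    (fun θ => r + 2 * Real.cos θ) '' Set.Ioo 0 Real.pi = Set.Ioo (r - 2) (r + 2) := by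
  ext x
  constructor
  · rintro ⟨θ, hθ, rfl⟩
    have h := Real.sin_pos_of_mem_Ioo hθ
    have h2 := Real.sin_sq_add_cos_sq θ
    have : |Real.cos θ| < 1 := (sq_lt_one_iff_abs_lt_one _).1 (by nlinarith)
    obtain ⟨h3, h4⟩ := abs_lt.1 this
    constructor <;> simp only <;> linarith
  · rintro ⟨h1, h2⟩
    refine ⟨Real.arccos ((x - r) / 2), ⟨Real.arccos_pos.2 (by linarith), ?_⟩, ?_⟩
    · exact lt_of_le_of_ne (Real.arccos_le_pi _) fun h => by
        rw [Real.arccos_eq_pi] at h; linarith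
    · simp only
      rw [Real.cos_arccos (by linarith) (by linarith)]
      ring

lemma hasDerivWithinAt_add_two_mul_cos (r θ : ℝ) (S : Set ℝ) :
    HasDerivWithinAt (fun θ => r + 2 * Real.cos θ) (-2 * Real.sin θ) S θ := by
  have := (((Real.hasDerivAt_cos θ).const_mul 2).const_add r).hasDerivWithinAt (s := S)
  exact this.congr_deriv (by ring)

lemma injOn_add_two_mul_cos (r : ℝ) :
    Set.InjOn (fun θ => r + 2 * Real.cos θ) (Set.Ioo 0 Real.pi) := by
  intro x hx y hy h
  refine Real.injOn_cos (Set.Ioo_subset_Icc_self hx) (Set.Ioo_subset_Icc_self hy) ?_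
  simp only at h
  linarith

lemma abs_mul_nuDensity_mul_fc {s : ℕ} (hs : 1 ≤ s) (c : ℝ) {θ : ℝ} (hθ : θ ∈ Set.Ioo 0 Real.pi) :
    |-2 * Real.sin θ| * (nuDensity s (√s + 2 * Real.cos θ) * fc s c (√s + 2 * Real.cos θ))
      = 2 / (Real.pi * (Real.exp (-c) + √s))
        * (1 / √s * chebWeight (-1 / √s) θ
          + Real.exp (-|c|) * chebWeight (Real.exp (-|c|)) θ) := by
  have hsin := Real.sin_pos_of_mem_Ioo hθ
  have hs2 := Real.sin_sq_add_cos_sq θ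
  have hr : 0 < √(s : ℝ) := by positivity
  have hsqrt : √(4 - (√s + 2 * Real.cos θ - √s) ^ 2) = 2 * Real.sin θ := by
    rw [show 4 - (√s + 2 * Real.cos θ - √s) ^ 2 = (2 * Real.sin θ) ^ 2 by
      linear_combination (-4) * hs2]
    exact Real.sqrt_sq (by positivity)
  have habs : |-2 * Real.sin θ| = 2 * Real.sin θ := by
    rw [abs_of_neg (by linarith)]; ring
  have hb := chebWeight_denom_pos (-1 / √s) hθ
  have ha := chebWeight_denom_pos (Real.exp (-|c|)) hθ
  have haq : Real.exp (-|c|) + (Real.exp (-|c|))⁻¹ = (Real.exp (-c))⁻¹ + Real.exp (-c) := by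
    rw [← Real.exp_neg, ← Real.exp_neg, neg_neg, neg_neg]
    rcases abs_cases c with ⟨h, _⟩ | ⟨h, _⟩ <;> rw [h]
    · ring
    · rw [neg_neg]
  rw [nuDensity, fc, hsqrt, habs, chebWeight, chebWeight]
  have hc : Real.exp c = (Real.exp (-c))⁻¹ := by rw [← Real.exp_neg, neg_neg]
  rw [hc]
  have hq := Real.exp_pos (-c)
  have hap := Real.exp_pos (-|c|)
  generalize Real.exp (-c) = q at *
  generalize Real.exp (-|c|) = a at *
  generalize √(s : ℝ) = r at *
  have e1 : (r + 2 * Real.cos θ) * r + 1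
      = r ^ 2 * (1 - 2 * (-1 / r) * Real.cos θ + (-1 / r) ^ 2) := by field_simp; ring
  have e2 : q⁻¹ + q + r - (r + 2 * Real.cos θ) = (1 - 2 * a * Real.cos θ + a ^ 2) / a := by
    rw [← haq]; field_simp; ring
  have hqr : q⁻¹ + r = (1 + q * r) / q := by field_simp
  have key : r * (1 - 2 * (-1 / r) * Real.cos θ + (-1 / r) ^ 2)
      + (1 - 2 * a * Real.cos θ + a ^ 2) / a = (1 + q * r) * (q + r) / (q * r) := by
    rw [← e2]; field_simp; ring
  rw [e1, e2, hqr]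
  generalize 1 - 2 * (-1 / r) * Real.cos θ + (-1 / r) ^ 2 = B at *
  generalize 1 - 2 * a * Real.cos θ + a ^ 2 = A at *
  have hpi := Real.pi_pos
  field_simp at key ⊢
  linear_combination (-1) * key

lemma withDensity_dirac_eq_smul (F : ℝ → ENNReal) (x : ℝ) :
    (Measure.dirac x).withDensity F = F x • Measure.dirac x := by
  classical
  ext S hS
  rw [withDensity_apply _ hS, setLIntegral_dirac]
  by_cases h : x ∈ S <;> simp [h, hS]

/-- The density of the absolutely continuous part of `etaMeas`. -/
noncomputable def etaDensity (s : ℕ) (c x : ℝ) : ENNReal :=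
  ENNReal.ofReal (if |x - √s| ≤ 2 then nuDensity s x else 0) * ENNReal.ofReal (fc s c x)

lemma measurable_ite_nuDensity (s : ℕ) :
    Measurable fun x => ENNReal.ofReal (if |x - √s| ≤ 2 then nuDensity s x else 0) := by
  refine (Measurable.ite ?_ (by unfold nuDensity; fun_prop) measurable_const).ennreal_ofReal
  exact measurableSet_le (by fun_prop) measurable_const

lemma measurable_fc (s : ℕ) (c : ℝ) : Measurable fun x => ENNReal.ofReal (fc s c x) := by
  unfold fc; fun_prop

lemma etaMeas_eq (s : ℕ) (c : ℝ) :
    etaMeas s c = volume.withDensity (etaDensity s c)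
      + (ENNReal.ofReal (1 - 1 / s) * ENNReal.ofReal (fc s c (-1 / √s))) • Measure.dirac (-1 / √s)
      + (if c < 0 then ENNReal.ofReal ((Real.exp (-c) - Real.exp c) / (Real.exp (-c) + √s))
          else 0) • Measure.dirac (Real.exp c + √s + Real.exp (-c)) := by
  rw [etaMeas, nuMeas, withDensity_add_measure, withDensity_smul_measure,
    withDensity_dirac_eq_smul, smul_smul, ← withDensity_mul _ (measurable_ite_nuDensity s)
      (measurable_fc s c)]
  rfl

lemma toReal_etaDensity {s : ℕ} (hs : 1 ≤ s) (c x : ℝ) :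
    (etaDensity s c x).toReal
      = (Set.Ioo (√s - 2) (√s + 2)).indicator (fun x => nuDensity s x * fc s c x) x := by
  have hr : 1 ≤ √(s : ℝ) := Real.one_le_sqrt.2 (by exact_mod_cast hs)
  rw [etaDensity, ENNReal.toReal_mul]
  by_cases hx : x ∈ Set.Ioo (√(s : ℝ) - 2) (√s + 2)
  · obtain ⟨h1, h2⟩ := hx
    rw [Set.indicator_of_mem (Set.mem_Ioo.2 ⟨h1, h2⟩), if_pos (abs_le.2 ⟨by linarith, by linarith⟩)]
    have hexp : 2 ≤ Real.exp c + Real.exp (-c) := by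
      have := Real.one_le_cosh c
      rw [Real.cosh_eq] at this
      linarith
    have := Real.exp_pos c
    have := Real.pi_pos
    rw [ENNReal.toReal_ofReal, ENNReal.toReal_ofReal]
    · exact div_nonneg (by linarith) (by linarith)
    · have : 0 ≤ x * √s + 1 := by nlinarith [sq_nonneg (√(s : ℝ) - 1)]
      unfold nuDensity
      positivity
  · rw [Set.indicator_of_notMem hx]
    split_ifs with h
    · have hsq : 4 - (x - √s) ^ 2 ≤ 0 := by
        by_contra! hlt
        have : |x - √s| < 2 := abs_lt_of_sq_lt_sq (by linarith) (by norm_num)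
        obtain ⟨h1, h2⟩ := abs_lt.1 this
        exact hx ⟨by linarith, by linarith⟩
      simp [nuDensity, Real.sqrt_eq_zero_of_nonpos hsq]
    · simp

lemma integral_withDensity_etaDensity {s : ℕ} (hs : 1 ≤ s) (c : ℝ) {g : ℝ → ℝ}
    (hg : Continuous g) :
    Integrable g (volume.withDensity (etaDensity s c)) ∧
    ∫ x, g x ∂(volume.withDensity (etaDensity s c))
      = 2 / (Real.pi * (Real.exp (-c) + √s))
        * (1 / √s * (∫ θ in Set.Ioo 0 Real.pi, chebWeight (-1 / √s) θ * g (√s + 2 * Real.cos θ))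
          + Real.exp (-|c|) * ∫ θ in Set.Ioo 0 Real.pi,
              chebWeight (Real.exp (-|c|)) θ * g (√s + 2 * Real.cos θ)) := by
  have hmeas : Measurable (etaDensity s c) :=
    (measurable_ite_nuDensity s).mul (measurable_fc s c)
  have hfin : ∀ᵐ x, etaDensity s c x < ⊤ :=
    ae_of_all _ fun x => ENNReal.mul_lt_top ENNReal.ofReal_lt_top ENNReal.ofReal_lt_top
  have hind : (fun x => (etaDensity s c x).toReal • g x)
      = (Set.Ioo (√s - 2) (√s + 2)).indicator (fun x => nuDensity s x * fc s c x * g x) := by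
    ext x
    rw [toReal_etaDensity hs, smul_eq_mul]
    by_cases hx : x ∈ Set.Ioo (√(s : ℝ) - 2) (√s + 2) <;> simp [hx]
  have hcongr : Set.EqOn
      (fun θ => |-2 * Real.sin θ| • (nuDensity s (√s + 2 * Real.cos θ)
        * fc s c (√s + 2 * Real.cos θ) * g (√s + 2 * Real.cos θ)))
      (fun θ => 2 / (Real.pi * (Real.exp (-c) + √s))
        * (1 / √s * (chebWeight (-1 / √s) θ * g (√s + 2 * Real.cos θ))
          + Real.exp (-|c|) * (chebWeight (Real.exp (-|c|)) θ * g (√s + 2 * Real.cos θ))))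
      (Set.Ioo 0 Real.pi) := fun θ hθ => by
    simp only [smul_eq_mul]
    rw [← mul_assoc, abs_mul_nuDensity_mul_fc hs c hθ]
    ring
  have hint (a : ℝ) : IntegrableOn (fun θ => chebWeight a θ * g (√s + 2 * Real.cos θ))
      (Set.Ioo 0 Real.pi) := integrableOn_chebWeight_mul a (by fun_prop)
  constructor
  · rw [integrable_withDensity_iff_integrable_smul' hmeas hfin, hind,
      integrable_indicator_iff measurableSet_Ioo, ← image_two_mul_cos,
      integrableOn_image_iff_integrableOn_abs_deriv_smul measurableSet_Ioo
        (fun θ _ => hasDerivWithinAt_add_two_mul_cos _ θ _) (injOn_add_two_mul_cos _),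
      integrableOn_congr_fun hcongr measurableSet_Ioo]
    exact (((hint _).const_mul _).add ((hint _).const_mul _)).const_mul _
  · rw [integral_withDensity_eq_integral_toReal_smul hmeas hfin, hind,
      integral_indicator measurableSet_Ioo, ← image_two_mul_cos,
      integral_image_eq_integral_abs_deriv_smul measurableSet_Ioo
        (fun θ _ => hasDerivWithinAt_add_two_mul_cos _ θ _) (injOn_add_two_mul_cos _),
      setIntegral_congr_fun measurableSet_Ioo hcongr, integral_const_mul,
      integral_add ((hint _).const_mul _) ((hint _).const_mul _), integral_const_mul,
      integral_const_mul]

lemma integrable_etaMeas {s : ℕ} (hs : 1 ≤ s) (c : ℝ) {g : ℝ → ℝ} (hg : Continuous g) :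
    Integrable g (etaMeas s c) := by
  rw [etaMeas_eq]
  refine ((integral_withDensity_etaDensity hs c hg).1.add_measure ?_).add_measure ?_
  · exact (integrable_dirac (by simp)).smul_measure
      (ENNReal.mul_ne_top ENNReal.ofReal_ne_top ENNReal.ofReal_ne_top)
  · refine (integrable_dirac (by simp)).smul_measure ?_
    split_ifs <;> simp

lemma integral_etaMeas {s : ℕ} (hs : 1 ≤ s) (c : ℝ) {g : ℝ → ℝ} (hg : Continuous g) :
    ∫ x, g x ∂(etaMeas s c)
      = 2 / (Real.pi * (Real.exp (-c) + √s))
        * (1 / √s * (∫ θ in Set.Ioo 0 Real.pi, chebWeight (-1 / √s) θ * g (√s + 2 * Real.cos θ))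
          + Real.exp (-|c|) * ∫ θ in Set.Ioo 0 Real.pi,
              chebWeight (Real.exp (-|c|)) θ * g (√s + 2 * Real.cos θ))
        + (√s - 1 / √s) / (Real.exp (-c) + √s) * g (-1 / √s)
        + (if c < 0 then (Real.exp (-c) - Real.exp c) / (Real.exp (-c) + √s) else 0)
          * g (Real.exp c + √s + Real.exp (-c)) := by
  have hi := integrable_etaMeas hs c hg
  have hr : 0 < √(s : ℝ) := by positivity
  have hr2 : √(s : ℝ) ^ 2 = s := Real.sq_sqrt (by positivity)
  have hq := Real.exp_pos (-c)
  have hc : Real.exp c = (Real.exp (-c))⁻¹ := by rw [← Real.exp_neg, neg_neg]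
  rw [etaMeas_eq] at hi ⊢
  rw [integral_add_measure hi.left_of_add_measure hi.right_of_add_measure,
    integral_add_measure hi.left_of_add_measure.left_of_add_measure
      hi.left_of_add_measure.right_of_add_measure,
    integral_smul_measure, integral_smul_measure, integral_dirac, integral_dirac,
    (integral_withDensity_etaDensity hs c hg).2, smul_eq_mul, smul_eq_mul]
  congr 3
  · have hfc : fc s c (-1 / √s) = √s / (Real.exp (-c) + √s) := by
      rw [fc, hc]
      generalize Real.exp (-c) = q at *
      generalize √(s : ℝ) = r at *
      have : q⁻¹ + q + r - -1 / r = (1 + q * r) * (q + r) / (q * r) := by field_simp; ring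
      rw [this]
      field_simp
    have hs' : (1 : ℝ) ≤ s := by exact_mod_cast hs
    rw [hfc, ENNReal.toReal_mul, ENNReal.toReal_ofReal, ENNReal.toReal_ofReal (by positivity)]
    · rw [show (1 : ℝ) / s = 1 / √s ^ 2 by rw [hr2]]
      field_simp
    · rw [sub_nonneg, div_le_one (by linarith)]; exact hs'
  · split_ifs with h
    · refine ENNReal.toReal_ofReal (div_nonneg ?_ (by positivity))
      rw [sub_nonneg, Real.exp_le_exp]
      linarith
    · simp

lemma integral_Qpoly_etaMeas {s : ℕ} (hs : 1 ≤ s) (c : ℝ) (n : ℕ) :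
    ∫ x, (Qpoly s n).eval x ∂(etaMeas s c) = Real.exp (-(c * n)) := by
  have hr1 : 1 ≤ √(s : ℝ) := Real.one_le_sqrt.2 (by exact_mod_cast hs)
  have hr : √(s : ℝ) ≠ 0 := by positivity
  have hb0 : -1 / √(s : ℝ) ≠ 0 := div_ne_zero (by norm_num) hr
  have hb1 : |-1 / √(s : ℝ)| ≤ 1 := by
    rw [abs_div, abs_neg, abs_one, abs_of_pos (by positivity), div_le_one (by positivity)]
    exact hr1
  have ha0 : Real.exp (-|c|) ≠ 0 := (Real.exp_pos _).ne'
  have ha1 : |Real.exp (-|c|)| ≤ 1 := by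
    rw [abs_of_pos (Real.exp_pos _), Real.exp_le_one_iff]
    simp
  have hq := Real.exp_pos (-c)
  have hc : Real.exp c = (Real.exp (-c))⁻¹ := by rw [← Real.exp_neg, neg_neg]
  have hpi := Real.pi_pos
  have hexp : Real.exp (-(c * n)) = Real.exp (-c) ^ n := by
    rw [← Real.exp_nat_mul]; congr 1; ring
  have hlast : (if c < 0 then (Real.exp (-c) - Real.exp c) / (Real.exp (-c) + √s) else 0)
      * (Qpoly s n).eval (Real.exp c + √s + Real.exp (-c))
      = if c < 0 then (Real.exp (-c) ^ (n + 1) - Real.exp c ^ (n + 1)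
        + √s * (Real.exp (-c) ^ n - Real.exp c ^ n)) / (Real.exp (-c) + √s) else 0 := by
    rw [hc]
    split_ifs
    · rw [← eval_Qpoly_mul_sub_inv s n hq.ne']; ring
    · simp
  rw [integral_etaMeas hs c (Qpoly s n).continuous, hlast, eval_Qpoly_neg_one_div hs, hexp]
  cases n with
  | zero =>
    rw [integral_chebWeight_mul_Qpoly_zero ha0 ha1, integral_chebWeight_mul_Qpoly_zero hb0 hb1]
    split_ifs with h
    · rw [abs_of_neg h, neg_neg]
      field_simp
      ring
    · rw [abs_of_nonneg (not_lt.1 h)]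
      field_simp
      ring
  | succ n =>
    rw [integral_chebWeight_mul_Qpoly_succ ha0 ha1, integral_chebWeight_mul_Qpoly_succ hb0 hb1]
    have hb : 1 / √(s : ℝ) = -(-1 / √s) := by ring
    have hbr : -1 / √(s : ℝ) * √s = -1 := by field_simp
    rw [hb]
    generalize -1 / √(s : ℝ) = b at *
    split_ifs with h
    · rw [abs_of_neg h, neg_neg]
      field_simp
      ring
    · rw [abs_of_nonneg (not_lt.1 h)]
      field_simp
      ring

lemma integrable_polynomial {μ : Measure ℝ} [IsFiniteMeasure μ]
    (hcomp : ∃ K : Set ℝ, IsCompact K ∧ μ Kᶜ = 0) (p : ℝ[X]) :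
    Integrable (fun x => p.eval x) μ := by
  obtain ⟨K, hK, h0⟩ := hcomp
  have h : IntegrableOn (fun x => p.eval x) K μ := p.continuous.continuousOn.integrableOn_compact hK
  rwa [IntegrableOn, Measure.restrict_eq_self_of_ae_mem (mem_ae_iff.2 h0)] at h

lemma integral_pow_mul_Qpoly_le {s : ℕ} {μ η : Measure ℝ}
    (hμ : ∀ p : ℝ[X], Integrable (fun x => p.eval x) μ)
    (hη : ∀ p : ℝ[X], Integrable (fun x => p.eval x) η)
    (h : ∀ n, ∫ x, (Qpoly s n).eval x ∂μ ≤ ∫ x, (Qpoly s n).eval x ∂η) (k n : ℕ) :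
    ∫ x, (X ^ k * Qpoly s n).eval x ∂μ ≤ ∫ x, (X ^ k * Qpoly s n).eval x ∂η := by
  induction k generalizing n with
  | zero => simpa using h n
  | succ k ih =>
    cases n with
    | zero =>
      have e : X ^ (k + 1) * Qpoly s 0 = X ^ k * Qpoly s 1 := by simp [Qpoly, pow_succ]
      rw [e]
      exact ih 1
    | succ n =>
      have e : X ^ (k + 1) * Qpoly s (n + 1) = X ^ k * Qpoly s (n + 2)
          + C √(s : ℝ) * (X ^ k * Qpoly s (n + 1)) + X ^ k * Qpoly s n := by
        simp only [Qpoly]; ring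
      have expand (ρ : Measure ℝ) (hρ : ∀ p : ℝ[X], Integrable (fun x => p.eval x) ρ) :
          ∫ x, (X ^ (k + 1) * Qpoly s (n + 1)).eval x ∂ρ
            = (∫ x, (X ^ k * Qpoly s (n + 2)).eval x ∂ρ)
              + √s * (∫ x, (X ^ k * Qpoly s (n + 1)).eval x ∂ρ)
              + ∫ x, (X ^ k * Qpoly s n).eval x ∂ρ := by
        have integral_eval_add (p q : ℝ[X]) : ∫ x, (p + q).eval x ∂ρ
            = (∫ x, p.eval x ∂ρ) + ∫ x, q.eval x ∂ρ := by
          simp only [eval_add]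
          exact integral_add (hρ p) (hρ q)
        have integral_eval_C_mul (a : ℝ) (p : ℝ[X]) : ∫ x, (C a * p).eval x ∂ρ
            = a * ∫ x, p.eval x ∂ρ := by
          simp only [eval_mul, eval_C]
          exact integral_const_mul _ _
        rw [e, integral_eval_add, integral_eval_add, integral_eval_C_mul]
      rw [expand μ hμ, expand η hη]
      exact add_le_add (add_le_add (ih _) (mul_le_mul_of_nonneg_left (ih _) (Real.sqrt_nonneg _)))
        (ih _)

/-- Even-moment domination: if `∫ Q_n^s dμ ≤ e^{-cn}` for all `n`, then the even
moments of `μ` are dominated by those of `η_c^s`. -/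
theorem stmt14 (s : ℕ) (hs : 1 ≤ s) (c : ℝ) (μ : Measure ℝ) [IsFiniteMeasure μ]
    (hcomp : ∃ K : Set ℝ, IsCompact K ∧ μ Kᶜ = 0)
    (hmom : ∀ n : ℕ, ∫ x, (Qpoly s n).eval x ∂μ ≤ Real.exp (-(c * n))) (m : ℕ) :
    ∫ x, x ^ (2 * m) ∂μ ≤ ∫ x, x ^ (2 * m) ∂(etaMeas s c) := by
  have h := integral_pow_mul_Qpoly_le (s := s) (integrable_polynomial hcomp)
    (fun p => integrable_etaMeas hs c p.continuous)
    (fun n => (hmom n).trans_eq (integral_Qpoly_etaMeas hs c n).symm) (2 * m) 0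
  simpa [Qpoly] using h
end
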